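/- There exists a constant c > 0 such that the following holds. Suppose G, H, W, k, n satisfy Assumption (★) with constant c. Let p > 1 be an integer and x a positive integer, and assume that for every positive integer y with a_{p−1}·y ≤ k, every simple arc-system ℬ in G of length at least a_{p−1}·y and size at least b_{p−1}·y^{(p−1)(p−2)/2} is such that G[ℬ] contains an independent set of size y^{p−1} + 1. Let 𝒜 be a simple arc-system of length at least a_p·x, let A ∈ 𝒜, and suppose there are a set S of at least |A|/6 vertices of A and pairwise disjoint sets (F_v) for v ∈ S, where each F_v is a set of at least b_{p−1}·x^{(p−1)(p−2)/2} + 1 arcs B ∈ 𝒜 whose main part M(B) contains a G-neighbour of v. Then either there exist arcs B, C ∈ 𝒜 such that (A, B, C) is a semi-triangle of Type 1, or G[𝒜] contains an independent set of size x^p + 1. -/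

import Mathlib

open Finset

/-- `σ` lists the vertices of `G` in the order of a Hamilton cycle `H`:
it is a bijection from `ZMod n` such that consecutive indices give adjacent vertices. -/
def IsHamOrder {V : Type} [Fintype V] (G : SimpleGraph V) (n : ℕ) (σ : ZMod n → V) : Prop :=
  Function.Bijective σ ∧ ∀ i : ZMod n, G.Adj (σ i) (σ (i + 1))

/-- A vertex is problematic if it has degree at most `2k` or belongs to `W`. -/
def Problematic {V : Type} [Fintype V] [DecidableEq V] (G : SimpleGraph V)
    [DecidableRel G.Adj] (W : Finset V) (k : ℕ) (v : V) : Prop :=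
  G.degree v ≤ 2 * k ∨ v ∈ W

/-- `G` has a cycle of length `ℓ` passing through all vertices of `S`. -/
def HasCycleThrough {V : Type} (G : SimpleGraph V) (ℓ : ℕ) (S : Set V) : Prop :=
  ∃ (u : V) (w : G.Walk u u), w.IsCycle ∧ w.length = ℓ ∧ ∀ x ∈ S, x ∈ w.support

/-- Assumption (★) with constant `c`: `G` is a graph on `n` vertices with Hamilton cycle
(order) `σ`, independence number at most `k`, `W` has at most `20k²` vertices, `G` has no
cycle of length `n − 1` through all of `W`, and `n ≥ c·k^(11/5)`. -/
def StarAssumption {V : Type} [Fintype V] [DecidableEq V] (G : SimpleGraph V) [DecidableRel G.Adj]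
    (n k : ℕ) (σ : ZMod n → V) (W : Finset V) (c : ℝ) : Prop :=
  Fintype.card V = n ∧ IsHamOrder G n σ ∧
  (∀ s : Finset V, (∀ u ∈ s, ∀ v ∈ s, u ≠ v → ¬ G.Adj u v) → s.card ≤ k) ∧
  W.card ≤ 20 * k ^ 2 ∧
  ¬ HasCycleThrough G (n - 1) (W : Set V) ∧
  c * (k : ℝ) ^ ((11 : ℝ) / 5) ≤ (n : ℝ)

/-- Two vertices are consecutive if they are neighbours on the Hamilton cycle. -/
def Consec {V : Type} (n : ℕ) (σ : ZMod n → V) (u v : V) : Prop :=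
  ∃ i : ZMod n, (σ i = u ∧ σ (i + 1) = v) ∨ (σ i = v ∧ σ (i + 1) = u)

/-- A continuous set of vertices: one forming a subpath (interval) of the Hamilton cycle. -/
def ContinuousSet {V : Type} [DecidableEq V] (n : ℕ) (σ : ZMod n → V) (S : Finset V) : Prop :=
  ∃ (i : ZMod n) (m : ℕ), S = (Finset.range m).image (fun j : ℕ => σ (i + (j : ZMod n)))

/-- `B` is a continuous closure of `A`: a minimum-size continuous set containing `A`. -/
def IsClosure {V : Type} [DecidableEq V] (n : ℕ) (σ : ZMod n → V) (A B : Finset V) : Prop :=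
  ContinuousSet n σ B ∧ A ⊆ B ∧
    ∀ B' : Finset V, ContinuousSet n σ B' → A ⊆ B' → B.card ≤ B'.card

/-- An arc-system: a family of arcs together with a choice of continuous closure for each
arc, such that closures of distinct arcs are disjoint, closures contain no problematic
vertex, and no arc contains two consecutive vertices. -/
structure ArcSystem {V : Type} [Fintype V] [DecidableEq V] (G : SimpleGraph V)
    [DecidableRel G.Adj] (n k : ℕ) (σ : ZMod n → V) (W : Finset V) where
  arcs : Finset (Finset V)
  cl : Finset V → Finset V
  closure_spec : ∀ A ∈ arcs, IsClosure n σ A (cl A)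
  closures_disjoint : ∀ A ∈ arcs, ∀ B ∈ arcs, A ≠ B → Disjoint (cl A) (cl B)
  no_problematic : ∀ A ∈ arcs, ∀ v ∈ cl A, ¬ Problematic G W k v
  no_consec : ∀ A ∈ arcs, ∀ u ∈ A, ∀ v ∈ A, u ≠ v → ¬ Consec n σ u v

namespace ArcSystem

variable {V : Type} [Fintype V] [DecidableEq V] {G : SimpleGraph V} [DecidableRel G.Adj]
  {n k : ℕ} {σ : ZMod n → V} {W : Finset V}

/-- An arc-system is independent if every closure has at most `k` vertices. -/
def Independent (𝒜 : ArcSystem G n k σ W) : Prop :=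
  ∀ A ∈ 𝒜.arcs, (𝒜.cl A).card ≤ k

/-- Every arc of the system has at least `l` vertices. -/
def LengthGe (𝒜 : ArcSystem G n k σ W) (l : ℕ) : Prop :=
  ∀ A ∈ 𝒜.arcs, l ≤ A.card

end ArcSystem

/-- A vertex set `s` is `M₂`-free (for `G`) if the subgraph induced by `s`
contains no two vertex-disjoint edges. -/
def M2Free {V : Type} (G : SimpleGraph V) (s : Finset V) : Prop :=
  ¬ ∃ a b x y : V, a ∈ s ∧ b ∈ s ∧ x ∈ s ∧ y ∈ s ∧ G.Adj a b ∧ G.Adj x y ∧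
      a ≠ x ∧ a ≠ y ∧ b ≠ x ∧ b ≠ y

namespace ArcSystem

variable {V : Type} [Fintype V] [DecidableEq V] {G : SimpleGraph V} [DecidableRel G.Adj]
  {n k : ℕ} {σ : ZMod n → V} {W : Finset V}

/-- An arc-system is simple if it is independent and any two distinct arcs induce an
`M₂`-free subgraph of `G`. -/
def Simple (𝒜 : ArcSystem G n k σ W) : Prop :=
  𝒜.Independent ∧ ∀ A ∈ 𝒜.arcs, ∀ B ∈ 𝒜.arcs, A ≠ B → M2Free G (A ∪ B)

end ArcSystem

/-- `G[𝒜]` contains an independent set of size at least `m`. -/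
def HasIndepInArcs {V : Type} [Fintype V] [DecidableEq V] (G : SimpleGraph V)
    [DecidableRel G.Adj] {n k : ℕ} {σ : ZMod n → V} {W : Finset V}
    (𝒜 : ArcSystem G n k σ W) (m : ℕ) : Prop :=
  ∃ I : Finset V, (∀ v ∈ I, ∃ A ∈ 𝒜.arcs, v ∈ A) ∧
    (∀ u ∈ I, ∀ v ∈ I, u ≠ v → ¬ G.Adj u v) ∧ m ≤ I.card

/-- The constants `a_p = 10·3^p`. -/
def aP (p : ℕ) : ℕ := 10 * 3 ^ p

/-- The constants `b_p = 1000^p·4^(p²)`. -/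
def bP (p : ℕ) : ℕ := 1000 ^ p * 4 ^ (p ^ 2)

/-- `i` is a starting index of the interval `B` along the Hamilton order `σ`:
`B` consists of the `|B|` consecutive vertices starting at `σ i`. -/
def IsStart {V : Type} [DecidableEq V] (n : ℕ) (σ : ZMod n → V) (B : Finset V)
    (i : ZMod n) : Prop :=
  B = (Finset.range B.card).image (fun j : ℕ => σ (i + (j : ZMod n)))

/-- `u` comes strictly before `v` in the direction of the Hamilton cycle, positions being
measured from the base index `i`. -/
def OrdFrom {V : Type} (n : ℕ) (σ : ZMod n → V) (i : ZMod n) (u v : V) : Prop :=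
  ∃ j₁ j₂ : ℕ, j₁ < j₂ ∧ j₂ < n ∧ σ (i + (j₁ : ZMod n)) = u ∧ σ (i + (j₂ : ZMod n)) = v

/-- `M` is the main part of the arc `A` whose continuous closure starts at `i`: the
`⌈|A|/2⌉` last vertices of `A` in the direction of the cycle. -/
def IsMainPart {V : Type} [DecidableEq V] (n : ℕ) (σ : ZMod n → V) (i : ZMod n)
    (A M : Finset V) : Prop :=
  M ⊆ A ∧ M.card = (A.card + 1) / 2 ∧ ∀ u ∈ A \ M, ∀ v ∈ M, OrdFrom n σ i u v

/-- `B` is the arc coming consecutively after `A` in the family `arcsSet`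
(with closures given by `cl`). -/
def NextArc {V : Type} [DecidableEq V] (n : ℕ) (σ : ZMod n → V)
    (arcsSet : Finset (Finset V)) (cl : Finset V → Finset V) (A B : Finset V) : Prop :=
  A ∈ arcsSet ∧ B ∈ arcsSet ∧ A ≠ B ∧ ∃ i : ZMod n, IsStart n σ (cl A) i ∧
    ∀ D ∈ arcsSet, D ≠ A → D ≠ B → ∀ b ∈ B, ∀ d ∈ D, OrdFrom n σ i b d

/-- `(A, B, C)` is a semi-triangle of Type 1 in the arc-system `𝒜`: the three arcs occur
in this cyclic order, `A` and `B` are not consecutive arcs, and there are `a₁ < a₂ ∈ A`,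
`b₁ < b₂ ∈ B`, `c₁ < c₂ ∈ C` with `{a₁,c₁}, {a₂,b₁}, {b₂,c₂} ∈ E(G)`. -/
def SemiTriangle1 {V : Type} [Fintype V] [DecidableEq V] (G : SimpleGraph V)
    [DecidableRel G.Adj] {n k : ℕ} {σ : ZMod n → V} {W : Finset V}
    (𝒜 : ArcSystem G n k σ W) (A B C : Finset V) : Prop :=
  A ∈ 𝒜.arcs ∧ B ∈ 𝒜.arcs ∧ C ∈ 𝒜.arcs ∧ A ≠ B ∧ B ≠ C ∧ A ≠ C ∧
  ¬ (NextArc n σ 𝒜.arcs 𝒜.cl A B ∨ NextArc n σ 𝒜.arcs 𝒜.cl B A) ∧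
  ∃ i : ZMod n, IsStart n σ (𝒜.cl A) i ∧
    (∀ a ∈ A, ∀ b ∈ B, OrdFrom n σ i a b) ∧
    (∀ b ∈ B, ∀ c ∈ C, OrdFrom n σ i b c) ∧
    ∃ a₁ ∈ A, ∃ a₂ ∈ A, ∃ b₁ ∈ B, ∃ b₂ ∈ B, ∃ c₁ ∈ C, ∃ c₂ ∈ C,
      OrdFrom n σ i a₁ a₂ ∧ OrdFrom n σ i b₁ b₂ ∧ OrdFrom n σ i c₁ c₂ ∧
      G.Adj a₁ c₁ ∧ G.Adj a₂ b₁ ∧ G.Adj b₂ c₂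


namespace Dk

section Count

noncomputable def wt (J H : Finset ℤ) (a b : ℤ) : ℤ :=
  ∑ j ∈ Finset.Ico a b, ((if j ∈ J then 1 else 0) - (if j ∈ H then 4 else 0))

lemma wt_split (J H : Finset ℤ) {a b c : ℤ} (h1 : a ≤ b) (h2 : b ≤ c) :
    wt J H a c = wt J H a b + wt J H b c := by
  unfold wt
  rw [← Finset.Ico_union_Ico_eq_Ico h1 h2, Finset.sum_union]
  rw [Finset.disjoint_left]
  intro x hx hy
  simp at hx hy
  omega

lemma wt_one (J H : Finset ℤ) (a : ℤ) :
    wt J H a (a+1) = (if a ∈ J then 1 else 0) - (if a ∈ H then 4 else 0) := by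
  unfold wt
  have : Finset.Ico a (a+1) = {a} := by
    ext x; simp; omega
  rw [this, Finset.sum_singleton]

lemma wt_self (J H : Finset ℤ) (a : ℤ) : wt J H a a = 0 := by
  simp [wt]

lemma wt_count (J H : Finset ℤ) (hHJ : H ⊆ J) (E : ℤ → ℕ → ℤ)
    (hE0 : ∀ D ∈ H, D < E D 0)
    (hEs : ∀ D ∈ H, ∀ i < 4, E D i < E D (i+1))
    (hEJ : ∀ D ∈ H, ∀ i < 4, E D i ∈ J)
    (hlam : ∀ D ∈ H, ∀ D' ∈ H, ∀ i ≤ 4, D < D' → D' < E D i → E D' 4 ≤ E D i) :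
    ∀ m : ℕ, ∀ a b : ℤ, a ≤ b → b - a ≤ m → (∀ D ∈ H, a ≤ D → D < b → E D 4 ≤ b) →
      0 ≤ wt J H a b ∧ ((∃ j ∈ J, a ≤ j ∧ j < b) → 1 ≤ wt J H a b) := by
  intro m
  induction m with
  | zero =>
    intro a b hab hm hc
    have : a = b := by push_cast at hm; omega
    subst this
    rw [wt_self]
    refine ⟨le_rfl, ?_⟩
    rintro ⟨j, _, h1, h2⟩
    omega
  | succ m ih =>
    intro a b hab hm hc
    push_cast at hm
    rcases eq_or_lt_of_le hab with rfl | hlt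
    · rw [wt_self]
      refine ⟨le_rfl, ?_⟩
      rintro ⟨j, _, h1, h2⟩
      omega
    by_cases haH : a ∈ H
    · have h0 := hE0 a haH
      have h1 := hEs a haH 0 (by norm_num)
      have h2 := hEs a haH 1 (by norm_num)
      have h3 := hEs a haH 2 (by norm_num)
      have h4 := hEs a haH 3 (by norm_num)
      have hb := hc a haH le_rfl hlt
      simp only [zero_add, Nat.reduceAdd] at h1 h2 h3 h4
      have cl : ∀ i ≤ 4, ∀ s, a < s → ∀ D ∈ H, s ≤ D → D < E a i → E D 4 ≤ E a i := by
        intro i hi s hs D hD hsD hDE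
        exact hlam a haH D hD i hi (by omega) hDE
      have r0 := (ih (a+1) (E a 0) (by omega) (by omega) (cl 0 (by norm_num) _ (by omega))).1
      have r1 := (ih (E a 0) (E a 1) (by omega) (by omega) (cl 1 (by norm_num) _ (by omega))).2
        ⟨E a 0, hEJ a haH 0 (by norm_num), le_rfl, by omega⟩
      have r2 := (ih (E a 1) (E a 2) (by omega) (by omega) (cl 2 (by norm_num) _ (by omega))).2
        ⟨E a 1, hEJ a haH 1 (by norm_num), le_rfl, by omega⟩
      have r3 := (ih (E a 2) (E a 3) (by omega) (by omega) (cl 3 (by norm_num) _ (by omega))).2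
        ⟨E a 2, hEJ a haH 2 (by norm_num), le_rfl, by omega⟩
      have r4 := (ih (E a 3) (E a 4) (by omega) (by omega) (cl 4 (by norm_num) _ (by omega))).2
        ⟨E a 3, hEJ a haH 3 (by norm_num), le_rfl, by omega⟩
      have r5 := (ih (E a 4) b (by omega) (by omega)
        (fun D hD h1 h2 => hc D hD (by omega) h2)).1
      have s0 := wt_split J H (a := a) (b := a+1) (c := b) (by omega) (by omega)
      have s1 := wt_split J H (a := a+1) (b := E a 0) (c := b) (by omega) (by omega)
      have s2 := wt_split J H (a := E a 0) (b := E a 1) (c := b) (by omega) (by omega)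
      have s3 := wt_split J H (a := E a 1) (b := E a 2) (c := b) (by omega) (by omega)
      have s4 := wt_split J H (a := E a 2) (b := E a 3) (c := b) (by omega) (by omega)
      have s5 := wt_split J H (a := E a 3) (b := E a 4) (c := b) (by omega) (by omega)
      have s6 := wt_one J H a
      rw [if_pos haH, if_pos (hHJ haH)] at s6
      constructor
      · omega
      · intro _; omega
    · have r := ih (a+1) b (by omega) (by omega) (fun D hD h1 h2 => hc D hD (by omega) h2)
      have s0 := wt_split J H (a := a) (b := a+1) (c := b) (by omega) (by omega)
      have s6 := wt_one J H a
      rw [if_neg haH] at s6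
      by_cases haJ : a ∈ J
      · rw [if_pos haJ] at s6
        constructor
        · omega
        · intro _; omega
      · rw [if_neg haJ] at s6
        constructor
        · omega
        · rintro ⟨j, hj, h1, h2⟩
          have : a ≠ j := by rintro rfl; exact haJ hj
          have := r.2 ⟨j, hj, by omega, h2⟩
          omega

lemma heavy_count (J H : Finset ℤ) (hHJ : H ⊆ J) (E : ℤ → ℕ → ℤ)
    (hE0 : ∀ D ∈ H, D < E D 0)
    (hEs : ∀ D ∈ H, ∀ i < 4, E D i < E D (i+1))
    (hEJ : ∀ D ∈ H, ∀ i ≤ 4, E D i ∈ J)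
    (hlam : ∀ D ∈ H, ∀ D' ∈ H, ∀ i ≤ 4, D < D' → D' < E D i → E D' 4 ≤ E D i) :
    4 * H.card ≤ J.card := by
  rcases J.eq_empty_or_nonempty with hJ | hJ
  · subst hJ
    have : H = ∅ := Finset.subset_empty.mp hHJ
    simp [this]
  set a := J.min' hJ
  set b := J.max' hJ + 1
  have hab : ∀ j ∈ J, a ≤ j ∧ j < b := fun j hj =>
    ⟨J.min'_le j hj, by have := J.le_max' j hj; omega⟩
  have hle : a ≤ b := by have := hab _ (J.min'_mem hJ); omega
  have h := (wt_count J H hHJ E hE0 hEs (fun D hD i hi => hEJ D hD i (by omega)) hlam (b-a).toNat a b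
    hle (by omega) (fun D hD _ _ => (hab _ (hEJ D hD 4 le_rfl)).2.le)).1
  unfold wt at h
  rw [Finset.sum_sub_distrib] at h
  have e1 : ∑ j ∈ Finset.Ico a b, (if j ∈ J then (1:ℤ) else 0) = J.card := by
    rw [← Finset.sum_filter]
    have : (Finset.Ico a b).filter (· ∈ J) = J := by
      ext x; simp; intro hx; exact hab x hx
    rw [this]; simp
  have e2 : ∑ j ∈ Finset.Ico a b, (if j ∈ H then (4:ℤ) else 0) = 4 * H.card := by
    rw [← Finset.sum_filter]
    have : (Finset.Ico a b).filter (· ∈ H) = H := by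
      ext x; simp; intro hx; exact hab x (hHJ hx)
    rw [this]; simp; ring
  rw [e1, e2] at h
  omega

end Count
end Dk


namespace Dk

abbrev Rel := ℤ → ℤ → ℤ → ℤ → Prop

def negR (adj : Rel) : Rel := fun j i j' i' => adj (-j) (-i) (-j') (-i')

def Tri (adj : Rel) (D E F : ℤ) : Prop :=
  D < E ∧ E < F ∧ ∃ d1 d2 e1 e2 f1 f2 : ℤ, d1 < d2 ∧ e1 < e2 ∧ f1 < f2 ∧
    adj D d2 E e1 ∧ adj D d1 F f1 ∧ adj E e2 F f2

structure PatR (adj : Rel) : Prop where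
  t2 : ∀ A B C a1 a2 b1 b2 c1 c2 : ℤ, A < B → B < C → a1 < a2 → b1 < b2 → c1 < c2 →
    adj A a1 B b1 → adj A a2 C c1 → adj B b2 C c2 → False
  sep : ∀ D E F D' E' F' : ℤ, Tri adj D E F → Tri adj D' E' F' → D < D' → D' < E → F < E' → False
  nest : ∀ D E F D' E' F' : ℤ, Tri adj D E F → Tri adj D' E' F' → D < D' → D' < E → E < E' →
    F' < F → False

def Indep (adj : Rel) (I : Finset (ℤ × ℤ)) : Prop :=
  ∀ u ∈ I, ∀ w ∈ I, ¬ adj u.1 u.2 w.1 w.2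

structure RHCtx (adj : Rel) (J : Finset ℤ) (F : ℤ → ℤ → Finset ℤ) (Main High : ℤ → Finset ℤ)
    (x N X : ℕ) : Prop where
  hpat : PatR adj
  symm : ∀ j i j' i', adj j i j' i' → adj j' i' j i
  hF : ∀ j ∈ J, ∀ v ∈ Main j, ∀ j' ∈ F j v, j' ∈ J ∧ ∃ i' ∈ Main j', adj j v j' i'
  hdisj : ∀ j ∈ J, ∀ v ∈ Main j, ∀ v' ∈ Main j, v ≠ v' → Disjoint (F j v) (F j v')
  hMH : ∀ j ∈ J, ∀ i ∈ Main j, ∀ i' ∈ High j, i < i'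
  hIH : ∀ J' ⊆ J, N ≤ J'.card → ∃ I : Finset (ℤ × ℤ), (∀ u ∈ I, u.1 ∈ J' ∧ u.2 ∈ High u.1) ∧
    Indep adj I ∧ X ≤ I.card
  hno : ¬ ∃ I : Finset (ℤ × ℤ), (∀ u ∈ I, u.1 ∈ J ∧ u.2 ∈ High u.1) ∧ Indep adj I ∧ x * X ≤ I.card
  hx : 1 ≤ x
  hN : 1 ≤ N

variable {adj : Rel} {J : Finset ℤ} {F : ℤ → ℤ → Finset ℤ} {Main High : ℤ → Finset ℤ} {x N X : ℕ}

lemma RHCtx.rich (h : RHCtx adj J F Main High x N X) {D : ℤ} (hD : D ∈ J) {z z' : ℤ} (hz : D ≤ z)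
    {T : Finset ℤ} (hT : T ⊆ Main D) (hx : x ≤ T.card)
    (hv : ∀ v ∈ T, N ≤ ((F D v).filter (fun j => z < j ∧ j ≤ z')).card) :
    ∃ E G, Tri adj D E G ∧ E ∈ J ∧ z < E ∧ G ≤ z' := by
  have hch : ∀ v, v ∈ T → ∃ I : Finset (ℤ × ℤ),
      (∀ u ∈ I, u.1 ∈ (F D v).filter (fun j => z < j ∧ j ≤ z') ∧ u.2 ∈ High u.1) ∧
      Indep adj I ∧ X ≤ I.card := by
    intro v hvT
    exact h.hIH _ (fun j hj => (h.hF D hD v (hT hvT) j (Finset.mem_filter.mp hj).1).1) (hv v hvT)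
  choose! I hI1 hI2 hI3 using hch
  by_contra hcon
  apply h.hno
  refine ⟨T.biUnion I, ?_, ?_, ?_⟩
  · intro u hu
    obtain ⟨v, hvT, hu⟩ := Finset.mem_biUnion.mp hu
    have := hI1 v hvT u hu
    exact ⟨(h.hF D hD v (hT hvT) _ (Finset.mem_filter.mp this.1).1).1, this.2⟩
  ·
    have key : ∀ v ∈ T, ∀ v' ∈ T, ∀ u ∈ I v, ∀ w ∈ I v', u.1 < w.1 →
        adj u.1 u.2 w.1 w.2 → False := by
      intro v hvT v' hvT' u hu w hw hlt hadj
      have hu1 := hI1 v hvT u hu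
      have hw1 := hI1 v' hvT' w hw
      have hu2 := Finset.mem_filter.mp hu1.1
      have hw2 := Finset.mem_filter.mp hw1.1
      obtain ⟨huJ, e, heM, hade⟩ := h.hF D hD v (hT hvT) _ hu2.1
      obtain ⟨hwJ, f, hfM, hadf⟩ := h.hF D hD v' (hT hvT') _ hw2.1
      have hlt1 := h.hMH _ huJ e heM _ hu1.2
      have hlt2 := h.hMH _ hwJ f hfM _ hw1.2
      rcases lt_trichotomy v v' with hl | rfl | hl
      · exact h.hpat.t2 D u.1 w.1 v v' e u.2 f w.2 (by omega) hlt hl hlt1 hlt2 hade hadf hadj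
      · exact hI2 v hvT u hu w hw hadj
      · exact hcon ⟨u.1, w.1, ⟨by omega, hlt, v', v, e, u.2, f, w.2, hl, hlt1, hlt2, hade, hadf,
          hadj⟩, huJ, hu2.2.1, hw2.2.2⟩
    intro u hu w hw hadj
    obtain ⟨v, hvT, hu⟩ := Finset.mem_biUnion.mp hu
    obtain ⟨v', hvT', hw⟩ := Finset.mem_biUnion.mp hw
    rcases lt_trichotomy u.1 w.1 with hl | he | hl
    · exact key v hvT v' hvT' u hu w hw hl hadj
    · by_cases hvv : v = v'
      · subst hvv
        exact hI2 v hvT u hu w hw hadj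
      · have h1 := (Finset.mem_filter.mp (hI1 v hvT u hu).1).1
        have h2 := (Finset.mem_filter.mp (hI1 v' hvT' w hw).1).1
        rw [he] at h1
        exact Finset.disjoint_left.mp (h.hdisj D hD v (hT hvT) v' (hT hvT') hvv) h1 h2
    · exact key v' hvT' v hvT w hw u hu hl (h.symm _ _ _ _ hadj)
  · rw [Finset.card_biUnion]
    · calc x * X ≤ T.card * X := Nat.mul_le_mul_right _ hx
        _ = ∑ v ∈ T, X := by simp
        _ ≤ _ := Finset.sum_le_sum (fun v hvT => hI3 v hvT)
    · intro v hvT v' hvT' hne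
      show Disjoint (I v) (I v')
      rw [Finset.disjoint_left]
      intro u hu hw
      have h1 := (Finset.mem_filter.mp (hI1 v hvT u hu).1).1
      have h2 := (Finset.mem_filter.mp (hI1 v' hvT' u hw).1).1
      exact Finset.disjoint_left.mp (h.hdisj D hD v (hT hvT) v' (hT hvT') hne) h1 h2

lemma RHCtx.units (h : RHCtx adj J F Main High x N X) {D : ℤ} (hD : D ∈ J) :
    ∀ r : ℕ, ∀ z : ℤ, D ≤ z → ∀ T ⊆ Main D, r * x ≤ T.card →
    (∀ v ∈ T, r * N ≤ ((F D v).filter (fun j => z < j)).card) →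
    ∃ E G : ℕ → ℤ, (∀ i < r, Tri adj D (E i) (G i) ∧ E i ∈ J ∧ z < E i) ∧
      ∀ i, i + 1 < r → G i < E (i+1) := by
  intro r
  induction r with
  | zero =>
    intro z hz T hT hc hv
    exact ⟨fun _ => 0, fun _ => 0, by intro i hi; omega, by intro i hi; omega⟩
  | succ r ih =>
    intro z hz T hT hc hv
    let P : ℕ → Prop := fun m =>
      x ≤ (T.filter (fun v => N ≤ ((F D v).filter (fun j => z < j ∧ j ≤ z + m)).card)).card
    have hex : ∃ m, P m := by
      obtain ⟨m, hm⟩ : ∃ m : ℕ, ∀ j ∈ J, j ≤ z + m := by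
        obtain ⟨M, hM⟩ := J.bddAbove
        refine ⟨(M - z).toNat, fun j hj => ?_⟩
        have := hM (Finset.mem_coe.mpr hj)
        omega
      refine ⟨m, ?_⟩
      have : T.filter (fun v => N ≤ ((F D v).filter (fun j => z < j ∧ j ≤ z + m)).card) = T := by
        apply Finset.filter_true_of_mem
        intro v hvT
        have h1 := hv v hvT
        have h2 : (F D v).filter (fun j => z < j ∧ j ≤ z + m) = (F D v).filter (fun j => z < j) := by
          apply Finset.filter_congr
          intro j hj
          have := hm j (h.hF D hD v (hT hvT) j hj).1
          simp [this]
        rw [h2]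
        nlinarith
      show x ≤ _
      rw [this]
      nlinarith
    classical
    have hP := Nat.find_spec hex
    set m := Nat.find hex with hmdef
    have hm0 : m ≠ 0 := by
      intro h0
      rw [h0] at hP
      have : T.filter (fun v => N ≤ ((F D v).filter (fun j => z < j ∧ j ≤ z + (0:ℕ))).card) = ∅ := by
        apply Finset.filter_false_of_mem
        intro v hvT
        have : (F D v).filter (fun j => z < j ∧ j ≤ z + (0:ℕ)) = ∅ := by
          apply Finset.filter_false_of_mem
          intro j hj
          push_cast
          omega
        rw [this]
        have := h.hN
        simp; omega
      have hP' : x ≤ _ := hP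
      rw [this] at hP'
      have := h.hx
      simp at hP'
      omega
    have hnP : ¬ P (m - 1) := Nat.find_min hex (by omega)
    obtain ⟨E0, G0, hT0, hE0J, hzE0, hG0⟩ := h.rich hD hz (z' := z + m)
      (T := T.filter (fun v => N ≤ ((F D v).filter (fun j => z < j ∧ j ≤ z + m)).card))
      ((Finset.filter_subset _ _).trans hT) hP (fun v hv => (Finset.mem_filter.mp hv).2)
    obtain ⟨E, G, hEG, hGE⟩ := ih (z + m) (by omega)
      (T.filter (fun v => ¬ N ≤ ((F D v).filter (fun j => z < j ∧ j ≤ z + (m - 1 : ℕ))).card))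
      ((Finset.filter_subset _ _).trans hT)
      (by
        have h1 := Finset.card_filter_add_card_filter_not (s := T)
          (fun v => N ≤ ((F D v).filter (fun j => z < j ∧ j ≤ z + (m - 1 : ℕ))).card)
        have h2 : ¬ x ≤ (T.filter (fun v => N ≤ ((F D v).filter (fun j => z < j ∧ j ≤ z + (m - 1 : ℕ))).card)).card := hnP
        have h3 : (r+1) * x = r * x + x := by ring
        omega)
      (by
        intro v hv'
        obtain ⟨hvT, hlt⟩ := Finset.mem_filter.mp hv'
        have h1 := hv v hvT
        have hsub : (F D v).filter (fun j => z < j) ⊆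
            ((F D v).filter (fun j => z < j ∧ j ≤ z + (m - 1 : ℕ)) ∪ {z + m}) ∪
              (F D v).filter (fun j => z + m < j) := by
          intro j hj
          simp only [Finset.mem_filter, Finset.mem_union, Finset.mem_singleton] at hj ⊢
          by_cases h1 : z + m < j
          · exact Or.inr ⟨hj.1, h1⟩
          · left
            by_cases h2 : j = z + m
            · exact Or.inr h2
            · exact Or.inl ⟨hj.1, hj.2, by omega⟩
        have h2 := (Finset.card_le_card hsub).trans (Finset.card_union_le _ _)
        have h3 := Finset.card_union_le ((F D v).filter (fun j => z < j ∧ j ≤ z + (m - 1 : ℕ)))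
          {z + (m:ℤ)}
        rw [Finset.card_singleton] at h3
        have h4 : (r+1) * N = r * N + N := by ring
        omega)
    refine ⟨fun i => Nat.casesOn i E0 E, fun i => Nat.casesOn i G0 G, ?_, ?_⟩
    · intro i hi
      cases i with
      | zero => exact ⟨hT0, hE0J, hzE0⟩
      | succ i =>
        obtain ⟨a, b, c⟩ := hEG i (by omega)
        exact ⟨a, b, by show z < E i; omega⟩
    · intro i hi
      cases i with
      | zero =>
        have := (hEG 0 (by omega)).2.2
        show G0 < E 0
        omega
      | succ i => exact hGE i (by omega)

lemma RHCtx.bound (h : RHCtx adj J F Main High x N X) :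
    4 * (J.filter (fun D => 6 * x ≤
      ((Main D).filter (fun v => 6 * N ≤ ((F D v).filter (fun j => D < j)).card)).card)).card
      ≤ J.card := by
  set H := J.filter (fun D => 6 * x ≤
      ((Main D).filter (fun v => 6 * N ≤ ((F D v).filter (fun j => D < j)).card)).card) with hH
  have hun : ∀ D, D ∈ H → ∃ E G : ℕ → ℤ, (∀ i < 6, Tri adj D (E i) (G i) ∧ E i ∈ J ∧ D < E i) ∧
      ∀ i, i + 1 < 6 → G i < E (i+1) := by
    intro D hD
    obtain ⟨hDJ, hc⟩ := Finset.mem_filter.mp hD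
    exact h.units hDJ 6 D le_rfl _ (Finset.filter_subset _ _) hc
      (fun v hv => (Finset.mem_filter.mp hv).2)
  choose! E G h1 h2 using hun
  have hs : ∀ D ∈ H, ∀ i < 5, E D i < E D (i+1) := by
    intro D hD i hi
    have a := (h1 D hD i (by omega)).1.2.1
    have b := h2 D hD i (by omega)
    omega
  refine heavy_count J H (Finset.filter_subset _ _) E (fun D hD => (h1 D hD 0 (by norm_num)).2.2)
    (fun D hD i hi => hs D hD i (by omega)) (fun D hD i hi => (h1 D hD i (by omega)).2.1) ?_
  intro D hD D' hD' i hi hDD hDE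
  by_contra hcon
  push Not at hcon
  have t := (h1 D hD i (by omega)).1
  have t4 := (h1 D' hD' 4 (by omega)).1
  have t5 := (h1 D' hD' 5 (by omega)).1
  have g := h2 D' hD' 4 (by omega)
  by_cases hc : G D i < E D' 5
  · exact h.hpat.sep _ _ _ _ _ _ t t5 hDD hDE hc
  · exact h.hpat.nest _ _ _ _ _ _ t t4 hDD hDE hcon (by simp only [Nat.reduceAdd] at g; omega)

end Dk


namespace Dk

lemma exists_coloring (w : ℤ → ℤ → ℕ) (r : ℕ) (hr : 1 ≤ r) (L : Finset ℤ) :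
    ∃ f : ℤ → ℕ, (∀ a, f a < r) ∧
      r * (∑ a ∈ L, ∑ b ∈ L, if a ≠ b ∧ f a = f b then w a b else 0) ≤
        ∑ a ∈ L, ∑ b ∈ L, w a b := by
  classical
  induction L using Finset.induction_on with
  | empty => exact ⟨fun _ => 0, fun _ => hr, by simp⟩
  | insert a0 L ha0 ih =>
    obtain ⟨f, hf, hsum⟩ := ih
    let g : ℕ → ℕ := fun c => ∑ b ∈ L, if f b = c then w a0 b + w b a0 else 0
    obtain ⟨c, hc, hmin⟩ := Finset.exists_min_image (Finset.range r) g ⟨0, by simp; omega⟩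
    have hgsum : ∑ c ∈ Finset.range r, g c = ∑ b ∈ L, (w a0 b + w b a0) := by
      simp only [g]
      rw [Finset.sum_comm]
      apply Finset.sum_congr rfl
      intro b hb
      rw [Finset.sum_ite_eq]
      simp [hf b]
    have hrg : r * g c ≤ ∑ b ∈ L, (w a0 b + w b a0) := by
      rw [← hgsum]
      calc r * g c = ∑ _c' ∈ Finset.range r, g c := by simp
        _ ≤ _ := Finset.sum_le_sum hmin
    refine ⟨Function.update f a0 c, ?_, ?_⟩
    · intro a
      by_cases h : a = a0
      · subst h; simpa using hc
      · simp [Function.update_of_ne h, hf a]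
    · have hne : ∀ b ∈ L, b ≠ a0 := by rintro b hb rfl; exact ha0 hb
      have e1 : (∑ a ∈ insert a0 L, ∑ b ∈ insert a0 L,
          if a ≠ b ∧ Function.update f a0 c a = Function.update f a0 c b then w a b else 0) =
          g c + ∑ a ∈ L, ∑ b ∈ L, if a ≠ b ∧ f a = f b then w a b else 0 := by
        rw [Finset.sum_insert ha0]
        rw [Finset.sum_insert ha0]
        have i1 : (∑ b ∈ L, if a0 ≠ b ∧ Function.update f a0 c a0 = Function.update f a0 c b
            then w a0 b else 0) = ∑ b ∈ L, if f b = c then w a0 b else 0 := by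
          apply Finset.sum_congr rfl
          intro b hb
          have := hne b hb
          rw [Function.update_self, Function.update_of_ne this]
          simp [this.symm, eq_comm]
        have i2 : (∑ a ∈ L, ∑ b ∈ insert a0 L,
            if a ≠ b ∧ Function.update f a0 c a = Function.update f a0 c b then w a b else 0) =
            ∑ a ∈ L, ((if f a = c then w a a0 else 0) +
              ∑ b ∈ L, if a ≠ b ∧ f a = f b then w a b else 0) := by
          apply Finset.sum_congr rfl
          intro a ha
          rw [Finset.sum_insert ha0]
          congr 1
          · have := hne a ha
            rw [Function.update_self, Function.update_of_ne this]
            simp [this]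
          · apply Finset.sum_congr rfl
            intro b hb
            rw [Function.update_of_ne (hne a ha), Function.update_of_ne (hne b hb)]
        rw [i1, i2, Finset.sum_add_distrib]
        have i3 : g c = (∑ b ∈ L, if f b = c then w a0 b else 0) +
            ∑ b ∈ L, if f b = c then w b a0 else 0 := by
          rw [← Finset.sum_add_distrib]
          apply Finset.sum_congr rfl
          intro b hb
          split_ifs <;> rfl
        rw [i3]
        simp
        ring
      rw [e1]
      rw [Finset.sum_insert ha0, Finset.sum_insert ha0]
      have i4 : (∑ a ∈ L, ∑ b ∈ insert a0 L, w a b) = ∑ a ∈ L, w a a0 + ∑ a ∈ L, ∑ b ∈ L, w a b := by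
        rw [← Finset.sum_add_distrib]
        apply Finset.sum_congr rfl
        intro b hb
        rw [Finset.sum_insert ha0]
      rw [i4]
      rw [Finset.sum_add_distrib] at hrg
      rw [mul_add]
      omega

lemma split_low (S : Finset ℤ) : ∀ m ≤ S.card, ∃ A ⊆ S, A.card = m ∧
    ∀ a ∈ A, ∀ b ∈ S \ A, a < b := by
  intro m
  induction m with
  | zero => intro _; exact ⟨∅, by simp, by simp, by simp⟩
  | succ m ih =>
    intro hm
    obtain ⟨A, hA, hc, hlt⟩ := ih (by omega)
    have hne : (S \ A).Nonempty := by
      rw [← Finset.card_pos, Finset.card_sdiff_of_subset hA]; omega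
    set y := (S \ A).min' hne
    have hy : y ∈ S \ A := Finset.min'_mem _ _
    have hyS := (Finset.mem_sdiff.mp hy)
    refine ⟨insert y A, ?_, ?_, ?_⟩
    · exact Finset.insert_subset hyS.1 hA
    · rw [Finset.card_insert_of_notMem hyS.2, hc]
    · intro a ha b hb
      have hb' := Finset.mem_sdiff.mp hb
      have hbA : b ∈ S \ A := Finset.mem_sdiff.mpr ⟨hb'.1, fun h => hb'.2 (Finset.mem_insert_of_mem h)⟩
      rcases Finset.mem_insert.mp ha with rfl | ha
      · have h1 := Finset.min'_le _ _ hbA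
        have h2 : b ≠ y := fun h => hb'.2 (h ▸ Finset.mem_insert_self _ _)
        exact lt_of_le_of_ne h1 (Ne.symm h2)
      · exact hlt a ha b hbA

def ng (S : Finset ℤ) : Finset ℤ := S.map (Equiv.neg ℤ).toEmbedding

@[simp] lemma mem_ng {S : Finset ℤ} {a : ℤ} : a ∈ ng S ↔ -a ∈ S := by
  unfold ng
  simp only [Finset.mem_map, Equiv.coe_toEmbedding, Equiv.neg_apply]
  constructor
  · rintro ⟨b, hb, rfl⟩; simpa
  · intro h; exact ⟨-a, h, by simp⟩

@[simp] lemma card_ng {S : Finset ℤ} : (ng S).card = S.card := by simp [ng]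

@[simp] lemma ng_ng {S : Finset ℤ} : ng (ng S) = S := by ext; simp

@[simp] lemma negR_negR (adj : Rel) : negR (negR adj) = adj := by
  funext a b c d; simp [negR]

structure Good (adj : Rel) : Prop where
  symm : ∀ j i j' i', adj j i j' i' → adj j' i' j i
  p0 : ∀ j i i', ¬ adj j i j i'
  pat : PatR adj
  patn : PatR (negR adj)

lemma Good.neg {adj : Rel} (h : Good adj) : Good (negR adj) :=
  ⟨fun _ _ _ _ h' => h.symm _ _ _ _ h', fun _ _ _ => h.p0 _ _ _, h.patn, by simpa using h.pat⟩

def M2F (adj : Rel) (J : Finset ℤ) (S : ℤ → Finset ℤ) : Prop :=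
  ∀ j ∈ J, ∀ j' ∈ J, j ≠ j' → ∀ i1 ∈ S j, ∀ i2 ∈ S j, ∀ i1' ∈ S j', ∀ i2' ∈ S j',
    i1 ≠ i2 → i1' ≠ i2' → adj j i1 j' i1' → adj j i2 j' i2' → False

def cA : ℕ → ℕ
  | 0 => 1
  | p+1 => 2 * cA p + 13

def cB : ℕ → ℕ
  | 0 => 1
  | p+1 => 96 * cB p

def cE : ℕ → ℕ
  | 0 => 0
  | p+1 => cE p + p

def Concl (adj : Rel) (J : Finset ℤ) (S : ℤ → Finset ℤ) (m : ℕ) : Prop :=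
  ∃ I : Finset (ℤ × ℤ), (∀ u ∈ I, u.1 ∈ J ∧ u.2 ∈ S u.1) ∧ Indep adj I ∧ m ≤ I.card

lemma Concl.neg {adj : Rel} {J : Finset ℤ} {S : ℤ → Finset ℤ} {m : ℕ} (h : Concl adj J S m) :
    Concl (negR adj) (ng J) (fun j => ng (S (-j))) m := by
  obtain ⟨I, h1, h2, h3⟩ := h
  refine ⟨I.map ((Equiv.neg ℤ).prodCongr (Equiv.neg ℤ)).toEmbedding, ?_, ?_, by simpa using h3⟩
  · intro u hu
    obtain ⟨v, hv, rfl⟩ := Finset.mem_map.mp hu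
    simpa using h1 v hv
  · intro u hu w hw
    obtain ⟨v, hv, rfl⟩ := Finset.mem_map.mp hu
    obtain ⟨v', hv', rfl⟩ := Finset.mem_map.mp hw
    simpa [negR] using h2 v hv v' hv'

lemma Concl.mono {adj : Rel} {J J' : Finset ℤ} {S S' : ℤ → Finset ℤ} {m : ℕ} (h : Concl adj J S m)
    (hJ : J ⊆ J') (hS : ∀ j ∈ J, S j ⊆ S' j) : Concl adj J' S' m := by
  obtain ⟨I, h1, h2, h3⟩ := h
  exact ⟨I, fun u hu => ⟨hJ (h1 u hu).1, hS _ (h1 u hu).1 (h1 u hu).2⟩, h2, h3⟩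

lemma M2F.mono {adj : Rel} {J J' : Finset ℤ} {S S' : ℤ → Finset ℤ} (h : M2F adj J' S')
    (hJ : J ⊆ J') (hS : ∀ j ∈ J, S j ⊆ S' j) : M2F adj J S := by
  intro j hj j' hj' hne i1 h1 i2 h2 i1' h1' i2' h2'
  exact h j (hJ hj) j' (hJ hj') hne i1 (hS _ hj h1) i2 (hS _ hj h2) i1' (hS _ hj' h1')
    i2' (hS _ hj' h2')

lemma M2F.neg {adj : Rel} {J : Finset ℤ} {S : ℤ → Finset ℤ} (h : M2F adj J S) :
    M2F (negR adj) (ng J) (fun j => ng (S (-j))) := by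
  intro j hj j' hj' hne i1 h1 i2 h2 i1' h1' i2' h2' n1 n2 a1 a2
  simp only [mem_ng] at *
  exact h (-j) hj (-j') hj' (by simpa using hne) (-i1) h1 (-i2) h2 (-i1') h1' (-i2') h2'
    (by simpa using n1) (by simpa using n2) a1 a2

/-- Light arcs yield a large independent set. -/
lemma light_stage {adj : Rel} (p0 : ∀ j i i', ¬ adj j i j i')
    {J L : Finset ℤ} {F : ℤ → ℤ → Finset ℤ} {Main Lam : ℤ → Finset ℤ}
    {x N X : ℕ} (hN : 1 ≤ N) (hLJ : L ⊆ J) (hLam : ∀ j ∈ L, Lam j ⊆ Main j)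
    (hcard : ∀ j ∈ L, (Lam j).card = x)
    (hF12 : ∀ j ∈ L, ∀ v ∈ Lam j, (F j v).card ≤ 12 * N)
    (hstar : ∀ j ∈ J, ∀ j' ∈ J, j ≠ j' → ∀ i ∈ Main j, ∀ i' ∈ Main j', adj j i j' i' →
      j' ∈ F j i ∨ j ∈ F j' i')
    (hbig : 24 * N * (x * X) * 2 ≤ L.card * x) :
    Concl adj J Main (x * X) := by
  classical
  let w : ℤ → ℤ → ℕ := fun a b => ((Lam a).filter (fun v => b ∈ F a v)).card
  obtain ⟨f, hf, hsum⟩ := exists_coloring w (24 * N) (by omega) L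
  have htot : ∑ a ∈ L, ∑ b ∈ L, w a b ≤ L.card * (x * (12 * N)) := by
    rw [← smul_eq_mul, ← Finset.sum_const]
    apply Finset.sum_le_sum
    intro a ha
    have : ∑ b ∈ L, w a b = ∑ v ∈ Lam a, (L.filter (fun b => b ∈ F a v)).card := by
      simp only [w, Finset.card_filter]
      rw [Finset.sum_comm]
    rw [this]
    calc _ ≤ ∑ v ∈ Lam a, 12 * N := by
          apply Finset.sum_le_sum
          intro v hv
          refine le_trans (Finset.card_le_card ?_) (hF12 a ha v hv)
          intro b hb; exact (Finset.mem_filter.mp hb).2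
      _ = _ := by rw [Finset.sum_const, hcard a ha]; rfl
  let bad : ℤ → ℤ → Prop := fun a v => ∃ b ∈ L, (a ≠ b ∧ f a = f b) ∧ b ∈ F a v
  have hbad : ∑ a ∈ L, ((Lam a).filter (fun v => bad a v)).card ≤
      ∑ a ∈ L, ∑ b ∈ L, if a ≠ b ∧ f a = f b then w a b else 0 := by
    apply Finset.sum_le_sum
    intro a ha
    rw [← Finset.sum_filter]
    refine le_trans (Finset.card_le_card ?_) Finset.card_biUnion_le
    intro v hv
    obtain ⟨hv1, b, hb, hab, hbF⟩ := Finset.mem_filter.mp hv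
    exact Finset.mem_biUnion.mpr ⟨b, Finset.mem_filter.mpr ⟨hb, hab⟩, Finset.mem_filter.mpr ⟨hv1, hbF⟩⟩
  let Sv : Finset (ℤ × ℤ) := (L.sigma fun a => (Lam a).filter (fun v => ¬ bad a v)).map
    (Equiv.sigmaEquivProd ℤ ℤ).toEmbedding
  have hSvc : Sv.card = ∑ a ∈ L, ((Lam a).filter (fun v => ¬ bad a v)).card := by
    simp [Sv, Finset.card_sigma]
  have hSvmem : ∀ u ∈ Sv, u.1 ∈ L ∧ u.2 ∈ Lam u.1 ∧ ¬ bad u.1 u.2 := by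
    intro u hu
    obtain ⟨s, hs, rfl⟩ := Finset.mem_map.mp hu
    obtain ⟨h1, h2⟩ := Finset.mem_sigma.mp hs
    obtain ⟨h2, h3⟩ := Finset.mem_filter.mp h2
    exact ⟨h1, h2, h3⟩
  have hadd : ∑ a ∈ L, ((Lam a).filter (fun v => bad a v)).card + Sv.card = L.card * x := by
    rw [hSvc, ← Finset.sum_add_distrib]
    rw [← smul_eq_mul, ← Finset.sum_const]
    apply Finset.sum_congr rfl
    intro a ha
    rw [Finset.card_filter_add_card_filter_not, hcard a ha]
  have hhalf : L.card * x ≤ 2 * Sv.card := by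
    have h1 : 24 * N * ∑ a ∈ L, ((Lam a).filter (fun v => bad a v)).card ≤ L.card * (x * (12 * N)) :=
      (Nat.mul_le_mul_left _ hbad).trans (hsum.trans htot)
    have h2 : 2 * ∑ a ∈ L, ((Lam a).filter (fun v => bad a v)).card ≤ L.card * x := by
      have : 12 * N * (2 * ∑ a ∈ L, ((Lam a).filter (fun v => bad a v)).card) ≤ 12 * N * (L.card * x) := by
        calc _ = 24 * N * ∑ a ∈ L, ((Lam a).filter (fun v => bad a v)).card := by ring
          _ ≤ _ := h1
          _ = _ := by ring
      exact Nat.le_of_mul_le_mul_left this (by omega)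
    omega
  obtain ⟨c, hc, hfib⟩ := Finset.exists_le_card_fiber_of_mul_le_card_of_maps_to
    (s := Sv) (t := Finset.range (24 * N)) (f := fun u => f u.1) (n := x * X)
    (fun u _ => Finset.mem_coe.mpr (Finset.mem_range.mpr (hf u.1))) ⟨0, by simp; omega⟩
    (by rw [Finset.card_range]; omega)
  refine ⟨Sv.filter (fun u => f u.1 = c), ?_, ?_, hfib⟩
  · intro u hu
    obtain ⟨h1, h2, _⟩ := hSvmem u (Finset.mem_filter.mp hu).1
    exact ⟨hLJ h1, hLam _ h1 h2⟩
  · intro u hu w hw hadj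
    obtain ⟨hu1, huc⟩ := Finset.mem_filter.mp hu
    obtain ⟨hw1, hwc⟩ := Finset.mem_filter.mp hw
    obtain ⟨h1, h2, h3⟩ := hSvmem u hu1
    obtain ⟨h1', h2', h3'⟩ := hSvmem w hw1
    have hne : u.1 ≠ w.1 := by
      intro h; rw [h] at hadj; exact p0 _ _ _ hadj
    rcases hstar _ (hLJ h1) _ (hLJ h1') hne _ (hLam _ h1 h2) _ (hLam _ h1' h2') hadj with h | h
    · exact h3 ⟨w.1, h1', ⟨hne, huc.trans hwc.symm⟩, h⟩
    · exact h3' ⟨u.1, h1, ⟨hne.symm, hwc.trans huc.symm⟩, h⟩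

end Dk


namespace Dk

lemma cB_pos (p : ℕ) : 1 ≤ cB p := by
  induction p with
  | zero => simp [cB]
  | succ p ih => simp only [cB]; omega

theorem core : ∀ p : ℕ, ∀ adj : Rel, Good adj → ∀ x : ℕ, 1 ≤ x → ∀ (J : Finset ℤ) (S : ℤ → Finset ℤ),
    (∀ j ∈ J, cA p * x ≤ (S j).card) → M2F adj J S → cB p * x ^ cE p ≤ J.card →
    Concl adj J S (x ^ p) := by
  classical
  intro p
  induction p with
  | zero =>
    intro adj hg x hx J S hS hM hJ
    simp only [cB, cE, pow_zero, mul_one, cA, one_mul] at *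
    obtain ⟨j, hj⟩ := Finset.card_pos.mp hJ
    obtain ⟨i, hi⟩ := Finset.card_pos.mp (lt_of_lt_of_le (by omega : 0 < x) (hS j hj))
    refine ⟨{(j, i)}, ?_, ?_, by simp⟩
    · intro u hu; rw [Finset.mem_singleton] at hu; subst hu; exact ⟨hj, hi⟩
    · intro u hu w hw
      rw [Finset.mem_singleton] at hu hw; subst hu hw
      exact hg.p0 _ _ _
  | succ p ih =>
    intro adj hg x hx J S hS hM hJ
    by_contra hno
    set N := cB p * x ^ cE p with hNdef
    set t := cA p * x with htdef
    have hN : 1 ≤ N := Nat.mul_pos (cB_pos p) (pow_pos hx _)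
    have hS' : ∀ j ∈ J, 2 * t + 13 * x ≤ (S j).card := by
      intro j hj
      refine le_trans (le_of_eq ?_) (hS j hj)
      simp only [cA, htdef]; ring
    have hspl : ∀ j, j ∈ J → ∃ Low Main High : Finset ℤ, Low ⊆ S j ∧ Main ⊆ S j ∧ High ⊆ S j ∧
        t ≤ Low.card ∧ 13 * x ≤ Main.card ∧ t ≤ High.card ∧
        (∀ i ∈ Main, ∀ i' ∈ High, i < i') ∧ (∀ i ∈ Low, ∀ i' ∈ Main, i < i') := by
      intro j hj
      obtain ⟨Low, h1, h2, h3⟩ := split_low (S j) t (by have := hS' j hj; omega)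
      have hc : (S j \ Low).card = (S j).card - t := by rw [Finset.card_sdiff_of_subset h1, h2]
      obtain ⟨Main, k1, k2, k3⟩ := split_low (S j \ Low) (13 * x) (by have := hS' j hj; omega)
      refine ⟨Low, Main, (S j \ Low) \ Main, h1, k1.trans Finset.sdiff_subset,
        Finset.sdiff_subset.trans Finset.sdiff_subset, h2.ge, k2.ge, ?_, k3,
        fun i hi i' hi' => h3 i hi i' (k1 hi')⟩
      rw [Finset.card_sdiff_of_subset k1, k2, hc]
      have := hS' j hj; omega
    choose! Low Main High hLS hMS hHS hLc hMc hHc hMH hLM using hspl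
    let F : ℤ → ℤ → Finset ℤ := fun j i => J.filter (fun j' => j' ≠ j ∧
      (∃ i' ∈ Main j', adj j i j' i') ∧ ∀ a ∈ Main j, ∀ b ∈ Main j', adj j a j' b → a = i)
    have hstar : ∀ j ∈ J, ∀ j' ∈ J, j ≠ j' → ∀ i ∈ Main j, ∀ i' ∈ Main j', adj j i j' i' →
        j' ∈ F j i ∨ j ∈ F j' i' := by
      intro j hj j' hj' hne i hi i' hi' hadj
      by_contra hcon
      push Not at hcon
      obtain ⟨hc1, hc2⟩ := hcon
      have : ∃ a ∈ Main j, ∃ b ∈ Main j', adj j a j' b ∧ a ≠ i := by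
        by_contra hh
        push Not at hh
        exact hc1 (Finset.mem_filter.mpr ⟨hj', hne.symm, ⟨i', hi', hadj⟩, hh⟩)
      obtain ⟨a, ha, b, hb, hab, hai⟩ := this
      have : ∃ a ∈ Main j', ∃ b ∈ Main j, adj j' a j b ∧ a ≠ i' := by
        by_contra hh
        push Not at hh
        exact hc2 (Finset.mem_filter.mpr ⟨hj, hne, ⟨i, hi, hg.symm _ _ _ _ hadj⟩, hh⟩)
      obtain ⟨c, hc, d, hd, hcd, hci⟩ := this
      have m := hM j hj j' hj' hne
      have hcd' := hg.symm _ _ _ _ hcd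
      have hbi : b = i' := by
        by_contra hbi
        exact m i (hMS j hj hi) a (hMS j hj ha) i' (hMS j' hj' hi') b (hMS j' hj' hb) hai.symm
          (Ne.symm hbi) hadj hab
      have hdi : d = i := by
        by_contra hdi
        exact m i (hMS j hj hi) d (hMS j hj hd) i' (hMS j' hj' hi') c (hMS j' hj' hc) (Ne.symm hdi)
          hci.symm hadj hcd'
      subst hbi hdi
      exact m d (hMS j hj hi) a (hMS j hj ha) c (hMS j' hj' hc) b (hMS j' hj' hb) hai.symm hci
        hcd' hab
    have hdisj : ∀ j ∈ J, ∀ v ∈ Main j, ∀ v' ∈ Main j, v ≠ v' → Disjoint (F j v) (F j v') := by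
      intro j hj v hv v' hv' hne
      rw [Finset.disjoint_left]
      intro b h1 h2
      obtain ⟨_, _, _, h1⟩ := Finset.mem_filter.mp h1
      obtain ⟨_, _, ⟨i', hi', had⟩, _⟩ := Finset.mem_filter.mp h2
      exact hne (h1 v' hv' i' hi' had).symm
    have hFm : ∀ j ∈ J, ∀ v ∈ Main j, ∀ j' ∈ F j v, j' ∈ J ∧ ∃ i' ∈ Main j', adj j v j' i' := by
      intro j hj v hv j' hj'
      obtain ⟨h1, _, h2, _⟩ := Finset.mem_filter.mp hj'
      exact ⟨h1, h2⟩
    have hpow : x ^ (p+1) = x * x ^ p := by ring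
    have ctxR : RHCtx adj J F Main High x N (x ^ p) := by
      refine ⟨hg.pat, hg.symm, hFm, hdisj, hMH, ?_, ?_, hx, hN⟩
      · intro J' hJ' hNJ
        exact ih adj hg x hx J' High (fun j hj => hHc j (hJ' hj))
          (hM.mono hJ' (fun j hj => hHS j (hJ' hj))) hNJ
      · intro hcon
        rw [← hpow] at hcon
        exact hno (Concl.mono hcon (Finset.Subset.refl _) hHS)
    have ctxL : RHCtx (negR adj) (ng J) (fun j v => ng (F (-j) (-v))) (fun j => ng (Main (-j)))
        (fun j => ng (Low (-j))) x N (x ^ p) := by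
      refine ⟨hg.patn, hg.neg.symm, ?_, ?_, ?_, ?_, ?_, hx, hN⟩
      · intro j hj v hv j' hj'
        simp only [mem_ng] at *
        obtain ⟨h1, i', hi', h2⟩ := hFm _ hj _ hv _ hj'
        exact ⟨h1, -i', by simpa using hi', by simpa [negR] using h2⟩
      · intro j hj v hv v' hv' hne
        simp only [mem_ng] at *
        have := hdisj _ hj _ hv _ hv' (by simpa using hne)
        rw [Finset.disjoint_left] at this ⊢
        intro b h1 h2
        exact this (mem_ng.mp h1) (mem_ng.mp h2)
      · intro j hj i hi i' hi'
        simp only [mem_ng] at *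
        have := hLM _ hj _ hi' _ hi
        omega
      · intro J' hJ' hNJ
        have hsub : ∀ j ∈ J', -j ∈ J := fun j hj => mem_ng.mp (hJ' hj)
        refine ih (negR adj) hg.neg x hx J' (fun j => ng (Low (-j))) (fun j hj => ?_) ?_ hNJ
        · rw [card_ng]; exact hLc _ (hsub j hj)
        · have h1 := hM.neg
          refine h1.mono hJ' (fun j hj i hi => ?_)
          simp only [mem_ng] at *
          exact hLS _ (hsub j hj) hi
      · intro hcon
        rw [← hpow] at hcon
        have h1 : Concl (negR adj) (ng J) (fun j => ng (Low (-j))) (x ^ (p+1)) := hcon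
        have h2 := h1.neg
        simp only [negR_negR, ng_ng, neg_neg] at h2
        exact hno (h2.mono (Finset.Subset.refl _) hLS)
    have bR := ctxR.bound
    have bL := ctxL.bound
    set HR := J.filter (fun D => 6 * x ≤
      ((Main D).filter (fun v => 6 * N ≤ ((F D v).filter (fun j => D < j)).card)).card) with hHR
    set HL := J.filter (fun D => 6 * x ≤
      ((Main D).filter (fun v => 6 * N ≤ ((F D v).filter (fun j => j < D)).card)).card) with hHL
    have eL : (ng J).filter (fun D => 6 * x ≤
        ((ng (Main (-D))).filter (fun v => 6 * N ≤ ((ng (F (-D) (-v))).filter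
          (fun j => D < j)).card)).card) = ng HL := by
      have e1 : ∀ D v, ((ng (F (-D) (-v))).filter (fun j => D < j)) =
          ng ((F (-D) (-v)).filter (fun j => j < -D)) := by
        intro D v; ext j
        simp only [Finset.mem_filter, mem_ng]
        have : D < j ↔ -j < -D := by omega
        rw [this]
      have e2 : ∀ D, ((ng (Main (-D))).filter (fun v => 6 * N ≤ ((ng (F (-D) (-v))).filter
          (fun j => D < j)).card)) = ng ((Main (-D)).filter (fun v => 6 * N ≤
            ((F (-D) v).filter (fun j => j < -D)).card)) := by
        intro D; ext v
        simp only [Finset.mem_filter, mem_ng, e1, card_ng]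
      ext D
      simp only [Finset.mem_filter, mem_ng, e2, card_ng, hHL]
    rw [eL, card_ng, card_ng] at bL
    set L := J \ (HR ∪ HL) with hL
    have hLc2 : J.card ≤ 2 * L.card := by
      have h1 : (J \ (HR ∪ HL)).card + (HR ∪ HL).card = J.card :=
        Finset.card_sdiff_add_card_eq_card (Finset.union_subset (Finset.filter_subset _ _) (Finset.filter_subset _ _))
      have h2 := Finset.card_union_le HR HL
      rw [← hL] at h1
      omega
    have hlam : ∀ j, j ∈ L → ∃ Lam ⊆ Main j, Lam.card = x ∧ ∀ v ∈ Lam, (F j v).card ≤ 12 * N := by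
      intro j hj
      obtain ⟨hjJ, hjn⟩ := Finset.mem_sdiff.mp hj
      rw [Finset.mem_union, not_or] at hjn
      obtain ⟨n1, n2⟩ := hjn
      rw [hHR, Finset.mem_filter, not_and] at n1
      rw [hHL, Finset.mem_filter, not_and] at n2
      replace n1 := n1 hjJ
      replace n2 := n2 hjJ
      set TR := (Main j).filter (fun v => 6 * N ≤ ((F j v).filter (fun j' => j < j')).card)
      set TL := (Main j).filter (fun v => 6 * N ≤ ((F j v).filter (fun j' => j' < j)).card)
      have hc : x ≤ (Main j \ (TR ∪ TL)).card := by
        have h1 : (Main j \ (TR ∪ TL)).card + (TR ∪ TL).card = (Main j).card :=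
          Finset.card_sdiff_add_card_eq_card (Finset.union_subset (Finset.filter_subset _ _) (Finset.filter_subset _ _))
        have h2 := Finset.card_union_le TR TL
        have h3 := hMc j hjJ
        omega
      obtain ⟨Lam, hl1, hl2⟩ := Finset.exists_subset_card_eq hc
      refine ⟨Lam, hl1.trans Finset.sdiff_subset, hl2, ?_⟩
      intro v hv
      obtain ⟨hvM, hvn⟩ := Finset.mem_sdiff.mp (hl1 hv)
      rw [Finset.mem_union, not_or] at hvn
      obtain ⟨m1, m2⟩ := hvn
      rw [Finset.mem_filter, not_and] at m1 m2
      replace m1 := m1 hvM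
      replace m2 := m2 hvM
      have hsub : F j v ⊆ (F j v).filter (fun j' => j < j') ∪ (F j v).filter (fun j' => j' < j) := by
        intro b hb
        have hbj : b ≠ j := (Finset.mem_filter.mp hb).2.1
        simp only [Finset.mem_union, Finset.mem_filter]
        rcases lt_or_gt_of_ne hbj with h | h
        · exact Or.inr ⟨hb, h⟩
        · exact Or.inl ⟨hb, h⟩
      have := (Finset.card_le_card hsub).trans (Finset.card_union_le _ _)
      omega
    choose! Lam hlam1 hlam2 hlam3 using hlam
    have hfin : Concl adj J Main (x * x ^ p) := by
      refine light_stage hg.p0 hN Finset.sdiff_subset hlam1 hlam2 hlam3 hstar ?_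
      have e : cB (p+1) * x ^ cE (p+1) = 96 * (N * x ^ p) := by
        simp only [cB, cE, hNdef, pow_add]; ring
      rw [e] at hJ
      have : 48 * (N * x ^ p) ≤ L.card := by omega
      calc 24 * N * (x * x ^ p) * 2 = 48 * (N * x ^ p) * x := by ring
        _ ≤ _ := Nat.mul_le_mul_right _ this
    rw [← hpow] at hfin
    exact hno (hfin.mono (Finset.Subset.refl _) hMS)

end Dk


namespace Dk

lemma low_deg (J : Finset ℤ) (hJ : J.Nonempty) (R : ℤ → ℤ → Prop)
    (hsymm : ∀ a b, R a b → R b a) (hirr : ∀ a, ¬ R a a)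
    (hnc : ∀ A ∈ J, ∀ C ∈ J, ∀ B ∈ J, ∀ D ∈ J, A < C → C < B → B < D → R A B → R C D → False) :
    ∃ v ∈ J, ∀ u ∈ J, R v u → ∀ w ∈ J, ¬ (v < w ∧ w < u) ∧ ¬ (u < w ∧ w < v) := by
  by_contra hcon
  push Not at hcon
  let P : ℕ → Prop := fun m => ∃ A ∈ J, ∃ B ∈ J, ∃ C ∈ J, A < C ∧ C < B ∧ R A B ∧ B - A = m
  have hstep : ∀ v ∈ J, ∃ A ∈ J, ∃ B ∈ J, ∃ C ∈ J, (A = v ∨ B = v) ∧ A < C ∧ C < B ∧ R A B := by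
    intro v hv
    obtain ⟨u, hu, huv, w, hw, h⟩ := hcon v hv
    by_cases h1 : v < w ∧ w < u
    · exact ⟨v, hv, u, hu, w, hw, Or.inl rfl, h1.1, h1.2, huv⟩
    · obtain ⟨h2, h3⟩ := h (by
        intro h4
        by_contra h5
        exact h1 ⟨h4, by omega⟩)
      exact ⟨u, hu, v, hv, w, hw, Or.inr rfl, h2, h3, hsymm _ _ huv⟩
  have hex : ∃ m, P m := by
    obtain ⟨v, hv⟩ := hJ
    obtain ⟨A, hA, B, hB, C, hC, _, h1, h2, h3⟩ := hstep v hv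
    exact ⟨(B - A).toNat, A, hA, B, hB, C, hC, h1, h2, h3, by omega⟩
  classical
  obtain ⟨A, hA, B, hB, C, hC, h1, h2, h3, h4⟩ := Nat.find_spec hex
  obtain ⟨A', hA', B', hB', C', hC', ho, k1, k2, k3⟩ := hstep C hC
  have hmin : Nat.find hex ≤ (B' - A').toNat :=
    Nat.find_min' hex ⟨A', hA', B', hB', C', hC', k1, k2, k3, by omega⟩
  rcases ho with rfl | rfl
  · by_cases hb : B < B'
    · exact hnc A hA A' hA' B hB B' hB' h1 h2 hb h3 k3
    · omega
  · by_cases hb : A' < A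
    · exact hnc A' hA' A hA B' hB' B hB hb h1 h2 k3 h3
    · omega

lemma nc_indep (R : ℤ → ℤ → Prop) (hsymm : ∀ a b, R a b → R b a) (hirr : ∀ a, ¬ R a a) :
    ∀ m : ℕ, ∀ J : Finset ℤ, J.card ≤ m →
    (∀ A ∈ J, ∀ C ∈ J, ∀ B ∈ J, ∀ D ∈ J, A < C → C < B → B < D → R A B → R C D → False) →
    ∃ J' ⊆ J, J.card ≤ 3 * J'.card ∧ ∀ a ∈ J', ∀ b ∈ J', ¬ R a b := by
  classical
  intro m
  induction m with
  | zero =>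
    intro J hJ _
    exact ⟨∅, by simp, by omega, by simp⟩
  | succ m ih =>
    intro J hJ hnc
    rcases J.eq_empty_or_nonempty with rfl | hne
    · exact ⟨∅, by simp, by simp, by simp⟩
    obtain ⟨v, hv, hvu⟩ := low_deg J hne R hsymm hirr hnc
    set J1 := J.filter (fun u => u ≠ v ∧ ¬ R v u) with hJ1
    have hsub : J1 ⊆ J := Finset.filter_subset _ _
    have hcard : J.card ≤ J1.card + 3 := by
      have hs : J ⊆ J1 ∪ ({v} ∪ (J.filter (fun u => R v u ∧ v < u) ∪ J.filter (fun u => R v u ∧ u < v))) := by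
        intro u hu
        simp only [hJ1, Finset.mem_union, Finset.mem_filter, Finset.mem_singleton]
        by_cases h1 : u = v
        · exact Or.inr (Or.inl h1)
        · by_cases h2 : R v u
          · rcases lt_or_gt_of_ne h1 with h | h
            · exact Or.inr (Or.inr (Or.inr ⟨hu, h2, h⟩))
            · exact Or.inr (Or.inr (Or.inl ⟨hu, h2, h⟩))
          · exact Or.inl ⟨hu, h1, h2⟩
      have c1 : (J.filter (fun u => R v u ∧ v < u)).card ≤ 1 := by
        rw [Finset.card_le_one]
        intro a ha b hb
        obtain ⟨ha1, ha2, ha3⟩ := Finset.mem_filter.mp ha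
        obtain ⟨hb1, hb2, hb3⟩ := Finset.mem_filter.mp hb
        have t1 := (hvu a ha1 ha2 b hb1).1
        have t2 := (hvu b hb1 hb2 a ha1).1
        omega
      have c2 : (J.filter (fun u => R v u ∧ u < v)).card ≤ 1 := by
        rw [Finset.card_le_one]
        intro a ha b hb
        obtain ⟨ha1, ha2, ha3⟩ := Finset.mem_filter.mp ha
        obtain ⟨hb1, hb2, hb3⟩ := Finset.mem_filter.mp hb
        have t1 := (hvu a ha1 ha2 b hb1).2
        have t2 := (hvu b hb1 hb2 a ha1).2
        omega
      have h1 := Finset.card_le_card hs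
      have h2 := Finset.card_union_le J1 ({v} ∪ (J.filter (fun u => R v u ∧ v < u) ∪ J.filter (fun u => R v u ∧ u < v)))
      have h3 := Finset.card_union_le {v} (J.filter (fun u => R v u ∧ v < u) ∪ J.filter (fun u => R v u ∧ u < v))
      have h4 := Finset.card_union_le (J.filter (fun u => R v u ∧ v < u)) (J.filter (fun u => R v u ∧ u < v))
      rw [Finset.card_singleton] at h3
      omega
    have hlt : J1.card < J.card := by
      apply Finset.card_lt_card
      refine ⟨hsub, fun h => ?_⟩
      exact (Finset.mem_filter.mp (h hv)).2.1 rfl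
    obtain ⟨J', h1, h2, h3⟩ := ih J1 (by omega) (fun A hA C hC B hB D hD =>
      hnc A (hsub hA) C (hsub hC) B (hsub hB) D (hsub hD))
    have hvJ' : v ∉ J' := fun h => (Finset.mem_filter.mp (h1 h)).2.1 rfl
    refine ⟨insert v J', Finset.insert_subset hv (h1.trans hsub), ?_, ?_⟩
    · rw [Finset.card_insert_of_notMem hvJ']; omega
    · intro a ha b hb
      rcases Finset.mem_insert.mp ha with ha | ha <;> rcases Finset.mem_insert.mp hb with hb | hb
      · rw [ha, hb]; exact hirr v
      · rw [ha]; exact (Finset.mem_filter.mp (h1 hb)).2.2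
      · rw [hb]; exact fun h => (Finset.mem_filter.mp (h1 ha)).2.2 (hsymm _ _ h)
      · exact h3 a ha b hb

structure Pat (adj : Rel) : Prop extends Good adj where
  p1 : ∀ A B a1 a2 b1 b2 : ℤ, A < B → a1 < a2 → b1 < b2 → adj A a1 B b1 → adj A a2 B b2 → False
  p3 : ∀ A B C D a1 a2 b1 b2 c1 c2 d1 d2 : ℤ, A < C → C < B → B < D → a1 < a2 → b1 < b2 → c1 < c2 →
    d1 < d2 → adj A a1 B b2 → adj A a2 B b1 → adj C c1 D d2 → adj C c2 D d1 → False

theorem main_comb {adj : Rel} (h : Pat adj) {x : ℕ} (hx : 1 ≤ x) {J : Finset ℤ} {S : ℤ → Finset ℤ}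
    (hS : ∀ j ∈ J, cA 5 * x ≤ (S j).card) (hJ : 3 * (cB 5 * x ^ cE 5) ≤ J.card) :
    Concl adj J S (x ^ 5) := by
  let R : ℤ → ℤ → Prop := fun j j' => ∃ i1 i2 i1' i2', i1 ≠ i2 ∧ i1' ≠ i2' ∧
    adj j i1 j' i1' ∧ adj j i2 j' i2'
  have hsymm : ∀ a b, R a b → R b a := by
    rintro a b ⟨i1, i2, i1', i2', h1, h2, h3, h4⟩
    exact ⟨i1', i2', i1, i2, h2, h1, h.symm _ _ _ _ h3, h.symm _ _ _ _ h4⟩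
  have hirr : ∀ a, ¬ R a a := by
    rintro a ⟨i1, i2, i1', i2', h1, h2, h3, h4⟩
    exact h.p0 _ _ _ h3
  have hnest : ∀ a b, a < b → R a b → ∃ a1 a2 b1 b2, a1 < a2 ∧ b1 < b2 ∧ adj a a1 b b2 ∧ adj a a2 b b1 := by
    rintro a b hab ⟨i1, i2, i1', i2', h1, h2, h3, h4⟩
    rcases lt_or_gt_of_ne h1 with l1 | l1 <;> rcases lt_or_gt_of_ne h2 with l2 | l2
    · exact (h.p1 _ _ _ _ _ _ hab l1 l2 h3 h4).elim
    · exact ⟨i1, i2, i2', i1', l1, l2, h3, h4⟩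
    · exact ⟨i2, i1, i1', i2', l1, l2, h4, h3⟩
    · exact (h.p1 _ _ _ _ _ _ hab l1 l2 h4 h3).elim
  obtain ⟨J', hs, hc, hi⟩ := nc_indep R hsymm hirr J.card J le_rfl (by
    intro A hA C hC B hB D hD h1 h2 h3 r1 r2
    obtain ⟨a1, a2, b1, b2, q1, q2, q3, q4⟩ := hnest A B (by omega) r1
    obtain ⟨c1, c2, d1, d2, t1, t2, t3, t4⟩ := hnest C D (by omega) r2
    exact h.p3 _ _ _ _ _ _ _ _ _ _ _ _ h1 h2 h3 q1 q2 t1 t2 q3 q4 t3 t4)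
  have := core 5 adj h.toGood x hx J' S (fun j hj => hS j (hs hj)) (by
    intro j hj j' hj' hne i1 _ i2 _ i1' _ i2' _ n1 n2 h1 h2
    exact hi j hj j' hj' ⟨i1, i2, i1', i2', n1, n2, h1, h2⟩) (by omega)
  exact this.mono hs (fun _ _ => Finset.Subset.refl _)

end Dk


namespace Dk

variable {V : Type}

def CycL (G : SimpleGraph V) (l : List V) : Prop :=
  l.Nodup ∧ l.IsChain G.Adj ∧ (∀ a ∈ l.head?, ∀ b ∈ l.getLast?, G.Adj b a)

lemma walk_of_chain (G : SimpleGraph V) : ∀ (l : List V) (a : V), (a :: l).IsChain G.Adj →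
    ∃ (b : V) (p : G.Walk a b), p.support = a :: l ∧ b ∈ (a :: l).getLast? := by
  intro l
  induction l with
  | nil => intro a _; exact ⟨a, SimpleGraph.Walk.nil, by simp, by simp⟩
  | cons c l ih =>
    intro a h
    rw [List.isChain_cons_cons] at h
    obtain ⟨b, p, h1, h2⟩ := ih c h.2
    refine ⟨b, SimpleGraph.Walk.cons h.1 p, by simp [h1], ?_⟩
    simpa using h2

lemma CycL.walk {G : SimpleGraph V} {l : List V} (h : CycL G l) (h3 : 3 ≤ l.length) :
    ∃ (u : V) (w : G.Walk u u), w.IsCycle ∧ w.length = l.length ∧ ∀ x ∈ l, x ∈ w.support := by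
  obtain ⟨h1, h2, h4⟩ := h
  cases l with
  | nil => simp at h3
  | cons a l =>
    obtain ⟨b, p, hp, hb⟩ := walk_of_chain G l a h2
    have hadj : G.Adj b a := h4 a (by simp) b hb
    have hpath : p.IsPath := by
      rw [SimpleGraph.Walk.isPath_def, hp]; exact h1
    have hlen : p.length + 1 = (a :: l).length := by
      rw [← hp, SimpleGraph.Walk.length_support]
    refine ⟨b, SimpleGraph.Walk.cons hadj p, ?_, ?_, ?_⟩
    · rw [SimpleGraph.Walk.cons_isCycle_iff]
      refine ⟨hpath, fun hm => ?_⟩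
      have := hpath.length_eq_one_of_mem_edges (by rwa [Sym2.eq_swap] at hm)
      omega
    · rw [SimpleGraph.Walk.length_cons, hlen]
    · intro x hx
      rw [SimpleGraph.Walk.support_cons, hp]
      exact List.mem_cons_of_mem _ hx

def segL (s t : ℤ) : List ℤ :=
  (List.range ((t - s).natAbs + 1)).map (fun i : ℕ => if s ≤ t then s + i else s - i)

lemma mem_segL {s t y : ℤ} : y ∈ segL s t ↔ (s ≤ y ∧ y ≤ t) ∨ (t ≤ y ∧ y ≤ s) := by
  unfold segL
  simp only [List.mem_map, List.mem_range]
  constructor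
  · rintro ⟨i, hi, rfl⟩
    split_ifs <;> omega
  · intro h
    refine ⟨(y - s).natAbs, by omega, ?_⟩
    split_ifs <;> omega

lemma nodup_segL (s t : ℤ) : (segL s t).Nodup := by
  unfold segL
  refine List.Nodup.map ?_ List.nodup_range
  intro i j h
  simp only at h
  split_ifs at h <;> omega

lemma head_segL (s t : ℤ) : (segL s t).head? = some s := by
  unfold segL
  rw [List.range_succ_eq_map]
  simp

lemma last_segL (s t : ℤ) : (segL s t).getLast? = some t := by
  unfold segL
  rw [List.range_succ]
  simp
  rcases abs_cases (t - s) with h | h <;> split_ifs <;> omega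

structure Cyc (G : SimpleGraph V) (c : ℤ → V) (N : ℕ) : Prop where
  adj : ∀ y, G.Adj (c y) (c (y+1))
  inj : ∀ y z, c y = c z ↔ (N : ℤ) ∣ y - z

lemma chain_segL {G : SimpleGraph V} {c : ℤ → V} (h : ∀ y, G.Adj (c y) (c (y+1))) (s t : ℤ) :
    ((segL s t).map c).IsChain G.Adj := by
  unfold segL
  rw [List.isChain_iff_getElem]
  intro i hi
  simp only [List.getElem_map, List.getElem_range]
  split_ifs
  · have := h (s + i)
    push_cast
    rwa [← add_assoc]
  · have := (h (s - (i + 1))).symm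
    push_cast
    rwa [show s - ((i:ℤ) + 1) + 1 = s - i by ring] at this

/-- The list of vertices of a route made of segments. -/
def route (c : ℤ → V) (L : List (ℤ × ℤ)) : List V := (L.flatMap (fun p => segL p.1 p.2)).map c

lemma route_cons (c : ℤ → V) (p : ℤ × ℤ) (L : List (ℤ × ℤ)) :
    route c (p :: L) = (segL p.1 p.2).map c ++ route c L := by
  simp [route]

lemma mem_route {c : ℤ → V} {L : List (ℤ × ℤ)} {x : V} :
    x ∈ route c L ↔ ∃ p ∈ L, ∃ y ∈ segL p.1 p.2, c y = x := by
  simp only [route, List.mem_map, List.mem_flatMap]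
  constructor
  · rintro ⟨y, ⟨p, hp, hy⟩, rfl⟩; exact ⟨p, hp, y, hy, rfl⟩
  · rintro ⟨p, hp, y, hy, rfl⟩; exact ⟨y, ⟨p, hp, hy⟩, rfl⟩

lemma route_head (c : ℤ → V) (p : ℤ × ℤ) (L : List (ℤ × ℤ)) :
    (route c (p :: L)).head? = some (c p.1) := by
  rw [route_cons, List.head?_append, List.head?_map, head_segL]; rfl

lemma route_last (c : ℤ → V) : ∀ (L : List (ℤ × ℤ)), (route c L).getLast? =
    (L.getLast?).map (fun p => c p.2) := by
  intro L
  induction L with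
  | nil => simp [route]
  | cons p L ih =>
    rw [route_cons, List.getLast?_append, ih, List.getLast?_map, last_segL, List.getLast?_cons]
    cases L.getLast? <;> simp

lemma route_chain {G : SimpleGraph V} {c : ℤ → V} (h : ∀ y, G.Adj (c y) (c (y+1))) :
    ∀ (L : List (ℤ × ℤ)), L.IsChain (fun p q => G.Adj (c p.2) (c q.1)) →
    (route c L).IsChain G.Adj := by
  intro L
  induction L with
  | nil => intro _; simp [route]
  | cons p L ih =>
    intro hL
    rw [route_cons, List.isChain_append]
    rw [List.isChain_cons] at hL
    refine ⟨chain_segL h _ _, ih hL.2, ?_⟩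
    intro x hx y hy
    rw [List.getLast?_map, last_segL] at hx
    cases L with
    | nil => simp [route] at hy
    | cons q L =>
      rw [route_head] at hy
      simp at hx hy
      subst hx hy
      exact hL.1 q (by simp)

def SegDisj (p q : ℤ × ℤ) : Prop := (p.1 < q.1 ∧ p.1 < q.2 ∧ p.2 < q.1 ∧ p.2 < q.2) ∨
  (q.1 < p.1 ∧ q.2 < p.1 ∧ q.1 < p.2 ∧ q.2 < p.2)

lemma Cyc.window {G : SimpleGraph V} {c : ℤ → V} {N : ℕ} (h : Cyc G c N) {w y z : ℤ}
    (h1 : w < y) (h2 : y ≤ w + N) (h3 : w < z) (h4 : z ≤ w + N) (he : c y = c z) : y = z := by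
  obtain ⟨q, hq⟩ := (h.inj y z).mp he
  have hq0 : q = 0 := by
    by_contra hq0
    rcases lt_or_gt_of_ne hq0 with hl | hl
    · have : (N:ℤ) * q ≤ N * (-1) := mul_le_mul_of_nonneg_left (by omega) (by omega)
      omega
    · have : (N:ℤ) * 1 ≤ N * q := mul_le_mul_of_nonneg_left (by omega) (by omega)
      omega
  subst hq0
  simp at hq
  omega

lemma route_nodup {G : SimpleGraph V} {c : ℤ → V} {N : ℕ} (h : Cyc G c N) (w : ℤ)
    (L : List (ℤ × ℤ)) (hw : ∀ p ∈ L, w < p.1 ∧ p.1 ≤ w + N ∧ w < p.2 ∧ p.2 ≤ w + N)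
    (hd : L.Pairwise SegDisj) : (route c L).Nodup := by
  unfold route
  refine List.Nodup.map_on ?_ ?_
  · intro y hy z hz he
    rw [List.mem_flatMap] at hy hz
    obtain ⟨p, hp, hy⟩ := hy
    obtain ⟨q, hq, hz⟩ := hz
    rw [mem_segL] at hy hz
    have := hw p hp
    have := hw q hq
    exact h.window (w := w) (by omega) (by omega) (by omega) (by omega) he
  · rw [List.nodup_flatMap]
    refine ⟨fun p _ => nodup_segL _ _, hd.imp ?_⟩
    intro p q hpq y hy hz
    rw [mem_segL] at hy hz
    unfold SegDisj at hpq
    omega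

lemma route_cycL {G : SimpleGraph V} {c : ℤ → V} {N : ℕ} (h : Cyc G c N) (w : ℤ)
    (p : ℤ × ℤ) (L : List (ℤ × ℤ))
    (hw : ∀ q ∈ p :: L, w < q.1 ∧ q.1 ≤ w + N ∧ w < q.2 ∧ q.2 ≤ w + N)
    (hd : (p :: L).Pairwise SegDisj)
    (hc : (p :: L).IsChain (fun p q => G.Adj (c p.2) (c q.1)))
    (hcl : ∀ q ∈ (p :: L).getLast?, G.Adj (c q.2) (c p.1)) : CycL G (route c (p :: L)) := by
  refine ⟨route_nodup h w _ hw hd, route_chain h.adj _ hc, ?_⟩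
  intro a ha b hb
  rw [route_head] at ha
  rw [route_last] at hb
  simp only [Option.mem_def, Option.map_eq_some_iff, Option.some.injEq] at ha hb
  obtain ⟨q, hq, rfl⟩ := hb
  subst ha
  exact hcl q hq

/-- Index a cyclic list by the integers. -/
lemma CycL.toCyc {G : SimpleGraph V} {l : List V} (h : CycL G l) (hl : 1 ≤ l.length) :
    ∃ c : ℤ → V, Cyc G c l.length ∧ (∀ x, x ∈ l ↔ ∃ y, c y = x) := by
  obtain ⟨h1, h2, h3⟩ := h
  set N := l.length with hN
  have hpos : (0:ℤ) < N := by omega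
  have hlt : ∀ y : ℤ, (y % N).toNat < l.length := by
    intro y
    have := Int.emod_lt_of_pos y hpos
    have := Int.emod_nonneg y hpos.ne'
    omega
  refine ⟨fun y => l[(y % N).toNat]'(hlt y), ⟨?_, ?_⟩, ?_⟩
  · intro y
    have e1 := Int.emod_lt_of_pos y hpos
    have e2 := Int.emod_nonneg y hpos.ne'
    by_cases hlast : y % N + 1 = N
    · have e3 : (y + 1) % N = 0 := by
        rw [← Int.emod_add_emod, hlast, Int.emod_self]
      simp only [e3]
      apply h3
      · rw [List.head?_eq_getElem?]; simp; 
      · rw [List.getLast?_eq_getElem?]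
        have : l.length - 1 = (y % N).toNat := by omega
        rw [this]
        simp [hlt y]
    · have e3 : (y + 1) % N = y % N + 1 := by
        rw [← Int.emod_add_emod]
        exact Int.emod_eq_of_lt (by omega) (by omega)
      have e4 : ((y + 1) % N).toNat = (y % N).toNat + 1 := by omega
      simp only [e4]
      exact (List.isChain_iff_getElem.mp h2) _ (by rw [← e4]; exact hlt _)
  · intro y z
    rw [h1.getElem_inj_iff]
    have a1 := Int.emod_nonneg y hpos.ne'
    have a2 := Int.emod_nonneg z hpos.ne'
    rw [← Int.emod_emod_of_dvd y (dvd_refl (N:ℤ))]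
    constructor
    · intro h
      have : y % N = z % N := by simp at h; omega
      exact Int.dvd_of_emod_eq_zero (Int.emod_eq_emod_iff_emod_sub_eq_zero.mp this)
    · intro h
      have : y % N = z % N := Int.emod_eq_emod_iff_emod_sub_eq_zero.mpr (Int.emod_eq_zero_of_dvd h)
      simp [this]
  · intro x
    constructor
    · intro hx
      obtain ⟨i, hi, rfl⟩ := List.getElem_of_mem hx
      refine ⟨i, ?_⟩
      have : ((i:ℤ) % N).toNat = i := by
        rw [Int.emod_eq_of_lt (by omega) (by omega)]; simp
      simp [this]
    · rintro ⟨y, rfl⟩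
      exact List.getElem_mem _

end Dk


namespace Dk

section
variable {V : Type} [Fintype V] [DecidableEq V] {G : SimpleGraph V} [DecidableRel G.Adj] {k : ℕ}

lemma insert_step (hα : ∀ s : Finset V, (∀ u ∈ s, ∀ v ∈ s, u ≠ v → ¬ G.Adj u v) → s.card ≤ k)
    {l : List V} (h : CycL G l) {w : V} (hw : w ∉ l)
    (hk : k < (l.toFinset.filter (fun x => G.Adj w x)).card) :
    ∃ l', CycL G l' ∧ ∀ x, x ∈ l' ↔ x = w ∨ x ∈ l := by
  have hl : 1 ≤ l.length := by
    obtain ⟨x, hx⟩ := Finset.card_pos.mp (lt_of_le_of_lt (Nat.zero_le _) hk)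
    have : x ∈ l := by simpa using (Finset.mem_filter.mp hx).1
    exact List.length_pos_of_mem this
  obtain ⟨c, hc, hcm⟩ := h.toCyc hl
  set N := l.length with hN
  have hNc : (0:ℤ) < N := by omega
  let Y := (Finset.Ico (0:ℤ) N).filter (fun y => G.Adj w (c y))
  have hY : k < Y.card := by
    refine lt_of_lt_of_le hk (le_trans (Finset.card_le_card ?_) (Finset.card_image_le (s := Y) (f := c)))
    intro x hx
    obtain ⟨h1, h2⟩ := Finset.mem_filter.mp hx
    rw [List.mem_toFinset, hcm] at h1
    obtain ⟨y, rfl⟩ := h1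
    have he : c (y % N) = c y := by
      rw [hc.inj]
      exact ⟨-(y / N), by have := Int.emod_add_mul_ediv y N; linarith⟩
    refine Finset.mem_image.mpr ⟨y % N, Finset.mem_filter.mpr ⟨?_, by rwa [he]⟩, he⟩
    rw [Finset.mem_Ico]
    exact ⟨Int.emod_nonneg _ hNc.ne', Int.emod_lt_of_pos _ hNc⟩
  have hinj : Set.InjOn (fun y => c (y+1)) (Y : Set ℤ) := by
    intro y hy z hz he
    have h1 := Finset.mem_Ico.mp (Finset.mem_filter.mp (Finset.mem_coe.mp hy)).1
    have h2 := Finset.mem_Ico.mp (Finset.mem_filter.mp (Finset.mem_coe.mp hz)).1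
    have := hc.window (w := 0) (y := y+1) (z := z+1) (by omega) (by omega) (by omega) (by omega) he
    omega
  have hZ : ¬ (∀ u ∈ Y.image (fun y => c (y+1)), ∀ v ∈ Y.image (fun y => c (y+1)), u ≠ v → ¬ G.Adj u v) := by
    intro hh
    have := hα _ hh
    rw [Finset.card_image_of_injOn hinj] at this
    omega
  push Not at hZ
  obtain ⟨u, hu, u', hu', hne, hadj⟩ := hZ
  obtain ⟨i, hi, rfl⟩ := Finset.mem_image.mp hu
  obtain ⟨j, hj, rfl⟩ := Finset.mem_image.mp hu'
  have key : ∀ i ∈ Y, ∀ j ∈ Y, i < j → G.Adj (c (i+1)) (c (j+1)) →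
      ∃ l', CycL G l' ∧ ∀ x, x ∈ l' ↔ x = w ∨ x ∈ l := by
    intro i hi j hj hij hadj
    obtain ⟨hi1, hi2⟩ := Finset.mem_filter.mp hi
    obtain ⟨hj1, hj2⟩ := Finset.mem_filter.mp hj
    rw [Finset.mem_Ico] at hi1 hj1
    have hci : c (i + N) = c i := by rw [hc.inj]; exact ⟨1, by ring⟩
    have hmem : ∀ x, x ∈ route c [(i + N, j+1), (i+1, j)] ↔ x ∈ l := by
      intro x
      rw [mem_route, hcm]
      constructor
      · rintro ⟨p, hp, y, hy, rfl⟩; exact ⟨y, rfl⟩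
      · rintro ⟨y, rfl⟩
        set y' := i + 1 + (y - (i+1)) % N with hy'
        have e1 := Int.emod_nonneg (y - (i+1)) hNc.ne'
        have e2 := Int.emod_lt_of_pos (y - (i+1)) hNc
        have he : c y' = c y := by
          rw [hc.inj]
          refine ⟨-((y - (i+1)) / N), ?_⟩
          have := Int.emod_add_mul_ediv (y - (i+1)) N
          rw [hy']; linarith
        by_cases hjy : y' ≤ j
        · exact ⟨(i+1, j), by simp, y', by rw [mem_segL]; left; constructor <;> simp only <;> omega, he⟩
        · exact ⟨(i + N, j+1), by simp, y', by rw [mem_segL]; right; constructor <;> simp only <;> omega, he⟩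
    refine ⟨w :: route c [(i + N, j+1), (i+1, j)], ⟨?_, ?_, ?_⟩, ?_⟩
    · rw [List.nodup_cons]
      refine ⟨fun hh => hw ((hmem w).mp hh), route_nodup hc i _ ?_ ?_⟩
      · intro p hp
        simp only [List.mem_cons, List.not_mem_nil, or_false] at hp
        rcases hp with rfl | rfl <;> simp only <;> omega
      · simp only [List.pairwise_cons, List.mem_singleton, forall_eq, SegDisj]
        refine ⟨?_, by simp⟩
        right; omega
    · rw [List.isChain_cons]
      refine ⟨?_, route_chain hc.adj _ ?_⟩
      · intro y hy
        rw [route_head] at hy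
        simp only [Option.mem_def, Option.some.injEq] at hy
        rw [← hy, hci]; exact hi2
      · simp only [List.isChain_cons_cons, List.isChain_singleton, and_true]
        exact hadj.symm
    · intro a ha b hb
      rw [List.getLast?_cons, route_last] at hb
      simp at ha hb
      rw [← ha, ← hb]
      exact hj2.symm
    · intro x
      rw [List.mem_cons, hmem]
  rcases lt_trichotomy i j with hlt | rfl | hlt
  · exact key i hi j hj hlt hadj
  · exact (hne rfl).elim
  · exact key j hj i hi hlt hadj.symm

lemma gh (hα : ∀ s : Finset V, (∀ u ∈ s, ∀ v ∈ s, u ≠ v → ¬ G.Adj u v) → s.card ≤ k)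
    {n D : ℕ} (hn : Fintype.card V = n) (hn4 : 4 ≤ n) {W : Finset V}
    (hno : ¬ ∃ (u : V) (w : G.Walk u u), w.IsCycle ∧ w.length = n - 1 ∧ ∀ x ∈ (W : Set V), x ∈ w.support) :
    ∀ (m : ℕ) (l : List V), CycL G l → (univ \ l.toFinset).card = m + 1 → m + 1 + k ≤ D →
      (∀ v, v ∉ l → D < G.degree v ∧ v ∉ W) → False := by
  intro m
  induction m with
  | zero =>
    intro l hl hc _ hP
    have hlen : l.length + 1 = n := by
      have h1 := Finset.card_sdiff_add_card_eq_card (Finset.subset_univ l.toFinset)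
      rw [hc, List.toFinset_card_of_nodup hl.1, Finset.card_univ, hn] at h1
      omega
    obtain ⟨u, w, h1, h2, h3⟩ := hl.walk (by omega)
    refine hno ⟨u, w, h1, by omega, fun x hx => h3 x ?_⟩
    by_contra hxl
    exact (hP x hxl).2 (Finset.mem_coe.mp hx)
  | succ m ih =>
    intro l hl hc hD hP
    obtain ⟨w, hw⟩ := Finset.card_pos.mp (by omega : 0 < (univ \ l.toFinset).card)
    have hwl : w ∉ l := by simpa using hw
    have hdeg := (hP w hwl).1
    have hk : k < (l.toFinset.filter (fun x => G.Adj w x)).card := by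
      have hsub : G.neighborFinset w ⊆ l.toFinset.filter (fun x => G.Adj w x) ∪
          (univ \ l.toFinset).erase w := by
        intro x hx
        rw [SimpleGraph.mem_neighborFinset] at hx
        by_cases hxl : x ∈ l
        · apply Finset.mem_union_left; simp [hxl, hx]
        · apply Finset.mem_union_right; simp [hxl, hx.ne']
      have h1 := (Finset.card_le_card hsub).trans (Finset.card_union_le _ _)
      rw [SimpleGraph.card_neighborFinset_eq_degree, Finset.card_erase_of_mem hw] at h1
      omega
    obtain ⟨l', h1, h2⟩ := insert_step hα hl hwl hk
    refine ih l' h1 ?_ (by omega) (fun v hv => hP v (fun h => hv ((h2 v).mpr (Or.inr h))))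
    have : univ \ l'.toFinset = (univ \ l.toFinset).erase w := by
      ext x
      simp [h2 x]
    rw [this, Finset.card_erase_of_mem hw]
    omega

lemma low_degree_indep (D : ℕ) : ∀ (m : ℕ) (U : Finset V), U.card ≤ m → (∀ v ∈ U, G.degree v ≤ D) →
    ∃ I ⊆ U, (∀ u ∈ I, ∀ v ∈ I, u ≠ v → ¬ G.Adj u v) ∧ U.card ≤ (D+1) * I.card := by
  intro m
  induction m with
  | zero => intro U hU _; exact ⟨∅, by simp, by simp, by omega⟩
  | succ m ih =>
    intro U hU hd
    rcases U.eq_empty_or_nonempty with rfl | ⟨v, hv⟩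
    · exact ⟨∅, by simp, by simp, by simp⟩
    set U1 := U.filter (fun u => u ≠ v ∧ ¬ G.Adj v u) with hU1
    have hlt : U1.card < U.card := by
      apply Finset.card_lt_card
      refine ⟨Finset.filter_subset _ _, fun h => ?_⟩
      exact (Finset.mem_filter.mp (h hv)).2.1 rfl
    have hcard : U.card ≤ U1.card + (D + 1) := by
      have hs : U ⊆ U1 ∪ insert v (G.neighborFinset v) := by
        intro u hu
        simp only [hU1, Finset.mem_union, Finset.mem_filter, Finset.mem_insert, SimpleGraph.mem_neighborFinset]
        tauto
      have h1 := (Finset.card_le_card hs).trans (Finset.card_union_le _ _)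
      have h2 := Finset.card_insert_le v (G.neighborFinset v)
      rw [SimpleGraph.card_neighborFinset_eq_degree] at h2
      have := hd v hv
      omega
    obtain ⟨I, h1, h2, h3⟩ := ih U1 (by omega) (fun u hu => hd u (Finset.filter_subset _ _ hu))
    have hvI : v ∉ I := fun h => (Finset.mem_filter.mp (h1 h)).2.1 rfl
    refine ⟨insert v I, Finset.insert_subset hv (h1.trans (Finset.filter_subset _ _)), ?_, ?_⟩
    · intro a ha b hb hab
      rcases Finset.mem_insert.mp ha with ha | ha <;> rcases Finset.mem_insert.mp hb with hb | hb
      · exact (hab (ha.trans hb.symm)).elim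
      · rw [ha]; exact (Finset.mem_filter.mp (h1 hb)).2.2
      · rw [hb]; exact fun h => (Finset.mem_filter.mp (h1 ha)).2.2 h.symm
      · exact h2 a ha b hb hab
    · rw [Finset.card_insert_of_notMem hvI]
      have : (D + 1) * (I.card + 1) = (D+1) * I.card + (D+1) := by ring
      omega

lemma low_degree_count (hα : ∀ s : Finset V, (∀ u ∈ s, ∀ v ∈ s, u ≠ v → ¬ G.Adj u v) → s.card ≤ k)
    (D : ℕ) : (univ.filter (fun v => G.degree v ≤ D)).card ≤ (D+1) * k := by
  obtain ⟨I, _, h2, h3⟩ := low_degree_indep (G := G) D _ (univ.filter (fun v => G.degree v ≤ D)) le_rfl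
    (fun v hv => (Finset.mem_filter.mp hv).2)
  exact h3.trans (Nat.mul_le_mul_left _ (hα I h2))

end
end Dk


namespace Dk

section
variable {V : Type} [Fintype V] [DecidableEq V] {G : SimpleGraph V}

/-- No cycle misses a nonempty small set of unproblematic vertices. -/
def GHyp (G : SimpleGraph V) (Pr : V → Prop) (M : ℕ) : Prop :=
  ∀ l : List V, CycL G l → (univ \ l.toFinset).Nonempty → (univ \ l.toFinset).card ≤ M →
    (∀ v, v ∉ l → ¬ Pr v) → False

structure Base (G : SimpleGraph V) (Pr : V → Prop) (g : ℕ) (c : ℤ → V) (N : ℕ) : Prop where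
  cyc : Cyc G c N
  pos : 0 < N
  surj : ∀ x, ∃ y, c y = x
  gh : GHyp G Pr (6 * g)

structure Gap (Pr : V → Prop) (g : ℕ) (c : ℤ → V) (e l : ℤ) : Prop where
  two : e + 2 ≤ l
  le : l ≤ e + g
  np : ∀ y, e < y → y < l → ¬ Pr (c y)

variable {Pr : V → Prop} {g : ℕ} {c : ℤ → V} {N : ℕ}

lemma Base.shift (h : Base G Pr g c N) (y : ℤ) : c (y + N) = c y := by
  rw [h.cyc.inj]; exact ⟨1, by ring⟩

lemma Base.route_false (h : Base G Pr g c N) (w : ℤ)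
    (p : ℤ × ℤ) (L gaps : List (ℤ × ℤ))
    (hw : ∀ q ∈ p :: L, w < q.1 ∧ q.1 ≤ w + N ∧ w < q.2 ∧ q.2 ≤ w + N)
    (hd : (p :: L).Pairwise SegDisj)
    (hc : (p :: L).IsChain (fun p q => G.Adj (c p.2) (c q.1)))
    (hcl : ∀ q ∈ (p :: L).getLast?, G.Adj (c q.2) (c p.1))
    (hlen : gaps.length ≤ 6)
    (hg : ∀ q ∈ gaps, Gap Pr g c q.1 q.2)
    (hcov : ∀ y, w < y → y ≤ w + N → (∃ q ∈ p :: L, (q.1 ≤ y ∧ y ≤ q.2) ∨ (q.2 ≤ y ∧ y ≤ q.1)) ∨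
      ∃ q ∈ gaps, q.1 < y ∧ y < q.2)
    (hmiss : ∀ q ∈ p :: L, w + 1 < q.1 ∧ w + 1 < q.2) : False := by
  have hN := h.pos
  have hcyc := route_cycL h.cyc w p L hw hd hc hcl
  have hT : ∀ v, v ∉ route c (p :: L) → ∃ q ∈ gaps, ∃ y, q.1 < y ∧ y < q.2 ∧ c y = v := by
    intro v hv
    obtain ⟨y, rfl⟩ := h.surj v
    have hNc : (0:ℤ) < N := by omega
    set y' := w + 1 + (y - (w+1)) % N with hy'
    have e1 := Int.emod_nonneg (y - (w+1)) hNc.ne'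
    have e2 := Int.emod_lt_of_pos (y - (w+1)) hNc
    have he : c y' = c y := by
      rw [h.cyc.inj]
      refine ⟨-((y - (w+1)) / N), ?_⟩
      have := Int.emod_add_mul_ediv (y - (w+1)) N
      rw [hy']; linarith
    rcases hcov y' (by omega) (by omega) with ⟨q, hq, h1⟩ | ⟨q, hq, h1, h2⟩
    · exact (hv (mem_route.mpr ⟨q, hq, y', mem_segL.mpr h1, he⟩)).elim
    · exact ⟨q, hq, y', h1, h2, he⟩
  refine h.gh _ hcyc ?_ ?_ ?_
  · refine ⟨c (w+1), ?_⟩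
    simp only [Finset.mem_sdiff, Finset.mem_univ, true_and, List.mem_toFinset]
    intro hm
    obtain ⟨q, hq, y, hy, he⟩ := mem_route.mp hm
    rw [mem_segL] at hy
    have h1 := hw q hq
    have h2 := hmiss q hq
    have := h.cyc.window (w := w) (by omega) (by omega) (by omega) (by omega) he
    omega
  · have hsub : univ \ (route c (p :: L)).toFinset ⊆
        gaps.toFinset.biUnion (fun q => (Finset.Ioo q.1 q.2).image c) := by
      intro v hv
      simp only [Finset.mem_sdiff, Finset.mem_univ, true_and, List.mem_toFinset] at hv
      obtain ⟨q, hq, y, h1, h2, rfl⟩ := hT v hv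
      exact Finset.mem_biUnion.mpr ⟨q, by simpa using hq, Finset.mem_image_of_mem _ (by simp [h1, h2])⟩
    refine (Finset.card_le_card hsub).trans ((Finset.card_biUnion_le_card_mul _ _ g ?_).trans ?_)
    · intro q hq
      refine Finset.card_image_le.trans ?_
      have := (hg q (by simpa using hq)).le
      rw [Int.card_Ioo]; omega
    · exact Nat.mul_le_mul_right _ ((List.toFinset_card_le _).trans hlen)
  · intro v hv
    obtain ⟨q, hq, y, h1, h2, rfl⟩ := hT v hv
    exact (hg q hq).np y h1 h2

lemma Base.pos0 (h : Base G Pr g c N) {a1 a2 : ℤ} (ga : Gap Pr g c a1 a2)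
    (hs : a2 < a1 + N) (e1 : G.Adj (c a1) (c a2)) : False := by
  have t1 := ga.two
  refine h.route_false a1 (a2, a1 + N) [] [(a1, a2)] ?_ ?_ ?_ ?_ (by simp) ?_ ?_ ?_
  · simp; omega
  · simp
  · simp
  · simpa [h.shift] using e1
  · simpa using ga
  · intro y h1 h2; simp; omega
  · simp; omega

lemma Base.pos1 (h : Base G Pr g c N) {a1 a2 b1 b2 : ℤ} (ga : Gap Pr g c a1 a2)
    (gb : Gap Pr g c b1 b2) (o1 : a2 < b1)
    (hs : b2 < a1 + N) (e1 : G.Adj (c a1) (c b1)) (e2 : G.Adj (c a2) (c b2)) : False := by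
  have t1 := ga.two
  have t2 := gb.two
  refine h.route_false a1 (b2, a1 + N) [(b1, a2)] [(a1, a2), (b1, b2)] ?_ ?_ ?_ ?_ (by simp) ?_ ?_ ?_
  · simp only [List.mem_cons, List.not_mem_nil, or_false, forall_eq_or_imp, forall_eq]; omega
  · simp only [List.pairwise_cons, SegDisj, List.mem_cons, List.not_mem_nil, or_false, forall_eq_or_imp,
      forall_eq, List.Pairwise.nil, and_true]
    simp; omega
  · simp [h.shift, e1]
  · simp [e2]
  · simp [ga, gb]
  · intro y h1 h2
    simp only [List.mem_cons, List.not_mem_nil, or_false, exists_eq_or_imp, exists_eq_left]; omega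
  · simp only [List.mem_cons, List.not_mem_nil, or_false, forall_eq_or_imp, forall_eq]; omega

end
end Dk

set_option linter.unusedSimpArgs false

namespace Dk

section
variable {V : Type} [Fintype V] [DecidableEq V] {G : SimpleGraph V}
variable {Pr : V → Prop} {g : ℕ} {c : ℤ → V} {N : ℕ}

lemma Base.pos2 (h : Base G Pr g c N) {a1 a2 b1 b2 x1 x2 : ℤ}
    (ga : Gap Pr g c a1 a2)
    (gb : Gap Pr g c b1 b2)
    (gx : Gap Pr g c x1 x2)
    (o0 : a2 < b1)
    (o1 : b2 < x1)
    (hs : x2 < a1 + N)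
    (w0 : G.Adj (c a1) (c b1))
    (w1 : G.Adj (c a2) (c x1))
    (w2 : G.Adj (c b2) (c x2))
    : False := by
  have t0 := ga.two
  have t1 := gb.two
  have t2 := gx.two
  refine h.route_false a1 (x2, a1 + N)
    [(b1, a2), (x1, b2)]
    [(a1, a2), (b1, b2), (x1, x2)]
    ?_ ?_ ?_ ?_ (by simp) ?_ ?_ ?_
  · simp only [List.mem_cons, List.not_mem_nil, or_false, forall_eq_or_imp, forall_eq]; omega
  · simp only [List.pairwise_cons, SegDisj, List.mem_cons, List.not_mem_nil, or_false,
      forall_eq_or_imp, forall_eq, List.Pairwise.nil, and_true]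
    simp; omega
  · simp [h.shift, w0, w0.symm, w1, w1.symm, w2, w2.symm]
  · simp [w0, w0.symm, w1, w1.symm, w2, w2.symm]
  · simp [ga, gb, gx]
  · intro y h1 h2
    simp only [List.mem_cons, List.not_mem_nil, or_false, exists_eq_or_imp, exists_eq_left]; omega
  · simp only [List.mem_cons, List.not_mem_nil, or_false, forall_eq_or_imp, forall_eq]; omega

lemma Base.pos3 (h : Base G Pr g c N) {a1 a2 x1 x2 b1 b2 d1 d2 : ℤ}
    (ga : Gap Pr g c a1 a2)
    (gx : Gap Pr g c x1 x2)
    (gb : Gap Pr g c b1 b2)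
    (gd : Gap Pr g c d1 d2)
    (o0 : a2 < x1)
    (o1 : x2 < b1)
    (o2 : b2 < d1)
    (hs : d2 < a1 + N)
    (w0 : G.Adj (c a1) (c b2))
    (w1 : G.Adj (c a2) (c b1))
    (w2 : G.Adj (c x1) (c d2))
    (w3 : G.Adj (c x2) (c d1))
    : False := by
  have t0 := ga.two
  have t1 := gx.two
  have t2 := gb.two
  have t3 := gd.two
  refine h.route_false a1 (d2, a1 + N)
    [(b2, d1), (x2, b1), (a2, x1)]
    [(a1, a2), (x1, x2), (b1, b2), (d1, d2)]
    ?_ ?_ ?_ ?_ (by simp) ?_ ?_ ?_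
  · simp only [List.mem_cons, List.not_mem_nil, or_false, forall_eq_or_imp, forall_eq]; omega
  · simp only [List.pairwise_cons, SegDisj, List.mem_cons, List.not_mem_nil, or_false,
      forall_eq_or_imp, forall_eq, List.Pairwise.nil, and_true]
    simp; omega
  · simp [h.shift, w0, w0.symm, w1, w1.symm, w2, w2.symm, w3, w3.symm]
  · simp [w0, w0.symm, w1, w1.symm, w2, w2.symm, w3, w3.symm]
  · simp [ga, gx, gb, gd]
  · intro y h1 h2
    simp only [List.mem_cons, List.not_mem_nil, or_false, exists_eq_or_imp, exists_eq_left]; omega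
  · simp only [List.mem_cons, List.not_mem_nil, or_false, forall_eq_or_imp, forall_eq]; omega

lemma Base.posSep (h : Base G Pr g c N) {d1 d2 D1 D2 e1 e2 f1 f2 E1 E2 F1 F2 : ℤ}
    (gd : Gap Pr g c d1 d2)
    (gD : Gap Pr g c D1 D2)
    (ge : Gap Pr g c e1 e2)
    (gf : Gap Pr g c f1 f2)
    (gE : Gap Pr g c E1 E2)
    (gF : Gap Pr g c F1 F2)
    (o0 : d2 < D1)
    (o1 : D2 < e1)
    (o2 : e2 < f1)
    (o3 : f2 < E1)
    (o4 : E2 < F1)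
    (hs : F2 < d1 + N)
    (w0 : G.Adj (c d2) (c e1))
    (w1 : G.Adj (c d1) (c f1))
    (w2 : G.Adj (c e2) (c f2))
    (w3 : G.Adj (c D2) (c E1))
    (w4 : G.Adj (c D1) (c F1))
    (w5 : G.Adj (c E2) (c F2))
    : False := by
  have t0 := gd.two
  have t1 := gD.two
  have t2 := ge.two
  have t3 := gf.two
  have t4 := gE.two
  have t5 := gF.two
  refine h.route_false d1 (F2, d1 + N)
    [(f1, e2), (f2, E1), (D2, e1), (d2, D1), (F1, E2)]
    [(d1, d2), (D1, D2), (e1, e2), (f1, f2), (E1, E2), (F1, F2)]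
    ?_ ?_ ?_ ?_ (by simp) ?_ ?_ ?_
  · simp only [List.mem_cons, List.not_mem_nil, or_false, forall_eq_or_imp, forall_eq]; omega
  · simp only [List.pairwise_cons, SegDisj, List.mem_cons, List.not_mem_nil, or_false,
      forall_eq_or_imp, forall_eq, List.Pairwise.nil, and_true]
    simp; omega
  · simp [h.shift, w0, w0.symm, w1, w1.symm, w2, w2.symm, w3, w3.symm, w4, w4.symm, w5, w5.symm]
  · simp [w0, w0.symm, w1, w1.symm, w2, w2.symm, w3, w3.symm, w4, w4.symm, w5, w5.symm]
  · simp [gd, gD, ge, gf, gE, gF]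
  · intro y h1 h2
    simp only [List.mem_cons, List.not_mem_nil, or_false, exists_eq_or_imp, exists_eq_left]; omega
  · simp only [List.mem_cons, List.not_mem_nil, or_false, forall_eq_or_imp, forall_eq]; omega

lemma Base.posNest (h : Base G Pr g c N) {d1 d2 D1 D2 e1 e2 E1 E2 F1 F2 f1 f2 : ℤ}
    (gd : Gap Pr g c d1 d2)
    (gD : Gap Pr g c D1 D2)
    (ge : Gap Pr g c e1 e2)
    (gE : Gap Pr g c E1 E2)
    (gF : Gap Pr g c F1 F2)
    (gf : Gap Pr g c f1 f2)
    (o0 : d2 < D1)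
    (o1 : D2 < e1)
    (o2 : e2 < E1)
    (o3 : E2 < F1)
    (o4 : F2 < f1)
    (hs : f2 < d1 + N)
    (w0 : G.Adj (c d2) (c e1))
    (w1 : G.Adj (c d1) (c f1))
    (w2 : G.Adj (c e2) (c f2))
    (w3 : G.Adj (c D2) (c E1))
    (w4 : G.Adj (c D1) (c F1))
    (w5 : G.Adj (c E2) (c F2))
    : False := by
  have t0 := gd.two
  have t1 := gD.two
  have t2 := ge.two
  have t3 := gE.two
  have t4 := gF.two
  have t5 := gf.two
  refine h.route_false d1 (f2, d1 + N)
    [(f1, F2), (E2, F1), (D1, d2), (e1, D2), (E1, e2)]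
    [(d1, d2), (D1, D2), (e1, e2), (E1, E2), (F1, F2), (f1, f2)]
    ?_ ?_ ?_ ?_ (by simp) ?_ ?_ ?_
  · simp only [List.mem_cons, List.not_mem_nil, or_false, forall_eq_or_imp, forall_eq]; omega
  · simp only [List.pairwise_cons, SegDisj, List.mem_cons, List.not_mem_nil, or_false,
      forall_eq_or_imp, forall_eq, List.Pairwise.nil, and_true]
    simp; omega
  · simp [h.shift, w0, w0.symm, w1, w1.symm, w2, w2.symm, w3, w3.symm, w4, w4.symm, w5, w5.symm]
  · simp [w0, w0.symm, w1, w1.symm, w2, w2.symm, w3, w3.symm, w4, w4.symm, w5, w5.symm]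
  · simp [gd, gD, ge, gE, gF, gf]
  · intro y h1 h2
    simp only [List.mem_cons, List.not_mem_nil, or_false, exists_eq_or_imp, exists_eq_left]; omega
  · simp only [List.mem_cons, List.not_mem_nil, or_false, forall_eq_or_imp, forall_eq]; omega

end
end Dk


namespace Dk

section
variable {V : Type} [Fintype V] [DecidableEq V] {G : SimpleGraph V}

structure Setup (G : SimpleGraph V) (Pr : V → Prop) (g : ℕ) (c : ℤ → V) (N : ℕ)
    (valid : ℤ → ℤ → Prop) (pos : ℤ → ℤ → ℤ) : Prop where
  base : Base G Pr g c N
  step : ∀ j i1 i2, valid j i1 → valid j i2 → i1 < i2 → Gap Pr g c (pos j i1) (pos j i2)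
  lt : ∀ j i j' i', valid j i → valid j' i' → j < j' → pos j i < pos j' i'
  span : ∀ j i j' i', valid j i → valid j' i' → pos j i < pos j' i' + N

def adjS (G : SimpleGraph V) (c : ℤ → V) (valid : ℤ → ℤ → Prop) (pos : ℤ → ℤ → ℤ) : Rel :=
  fun j i j' i' => valid j i ∧ valid j' i' ∧ G.Adj (c (pos j i)) (c (pos j' i'))

variable {Pr : V → Prop} {g : ℕ} {c : ℤ → V} {N : ℕ} {valid : ℤ → ℤ → Prop} {pos : ℤ → ℤ → ℤ}

lemma Setup.patR (h : Setup G Pr g c N valid pos) : PatR (adjS G c valid pos) where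
  t2 := by
    rintro A B C a1 a2 b1 b2 c1 c2 hAB hBC ha hb hc ⟨va1, vb1, e1⟩ ⟨va2, vc1, e2⟩ ⟨vb2, vc2, e3⟩
    exact h.base.pos2 (h.step A a1 a2 va1 va2 ha) (h.step B b1 b2 vb1 vb2 hb)
      (h.step C c1 c2 vc1 vc2 hc) (h.lt _ _ _ _ va2 vb1 hAB) (h.lt _ _ _ _ vb2 vc1 hBC)
      (h.span _ _ _ _ vc2 va1) e1 e2 e3
  sep := by
    rintro D E F D' E' F' ⟨hDE, hEF, d1, d2, e1, e2, f1, f2, hd, he, hf, ⟨vd2, ve1, w0⟩,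
      ⟨vd1, vf1, w1⟩, ⟨ve2, vf2, w2⟩⟩ ⟨hDE', hEF', d1', d2', e1', e2', f1', f2', hd', he', hf',
      ⟨vd2', ve1', w0'⟩, ⟨vd1', vf1', w1'⟩, ⟨ve2', vf2', w2'⟩⟩ h1 h2 h3
    exact h.base.posSep (h.step D d1 d2 vd1 vd2 hd) (h.step D' d1' d2' vd1' vd2' hd')
      (h.step E e1 e2 ve1 ve2 he) (h.step F f1 f2 vf1 vf2 hf)
      (h.step E' e1' e2' ve1' ve2' he') (h.step F' f1' f2' vf1' vf2' hf')
      (h.lt _ _ _ _ vd2 vd1' h1) (h.lt _ _ _ _ vd2' ve1 h2) (h.lt _ _ _ _ ve2 vf1 hEF)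
      (h.lt _ _ _ _ vf2 ve1' h3) (h.lt _ _ _ _ ve2' vf1' hEF') (h.span _ _ _ _ vf2' vd1)
      w0 w1 w2 w0' w1' w2'
  nest := by
    rintro D E F D' E' F' ⟨hDE, hEF, d1, d2, e1, e2, f1, f2, hd, he, hf, ⟨vd2, ve1, w0⟩,
      ⟨vd1, vf1, w1⟩, ⟨ve2, vf2, w2⟩⟩ ⟨hDE', hEF', d1', d2', e1', e2', f1', f2', hd', he', hf',
      ⟨vd2', ve1', w0'⟩, ⟨vd1', vf1', w1'⟩, ⟨ve2', vf2', w2'⟩⟩ h1 h2 h3 h4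
    exact h.base.posNest (h.step D d1 d2 vd1 vd2 hd) (h.step D' d1' d2' vd1' vd2' hd')
      (h.step E e1 e2 ve1 ve2 he) (h.step E' e1' e2' ve1' ve2' he')
      (h.step F' f1' f2' vf1' vf2' hf') (h.step F f1 f2 vf1 vf2 hf)
      (h.lt _ _ _ _ vd2 vd1' h1) (h.lt _ _ _ _ vd2' ve1 h2) (h.lt _ _ _ _ ve2 ve1' h3)
      (h.lt _ _ _ _ ve2' vf1' hEF') (h.lt _ _ _ _ vf2' vf1 h4) (h.span _ _ _ _ vf2 vd1)
      w0 w1 w2 w0' w1' w2'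

lemma Setup.mirror (h : Setup G Pr g c N valid pos) :
    Setup G Pr g (fun y => c (-y)) N (fun j i => valid (-j) (-i)) (fun j i => - pos (-j) (-i)) where
  base :=
    { cyc :=
        { adj := by
            intro y
            have := h.base.cyc.adj (-(y+1))
            rw [show -(y+1) + 1 = -y by ring] at this
            exact this.symm
          inj := by
            intro y z
            rw [h.base.cyc.inj, show -y - -z = -(y - z) by ring, dvd_neg] }
      pos := h.base.pos
      surj := by
        intro x
        obtain ⟨y, hy⟩ := h.base.surj x
        exact ⟨-y, by simpa using hy⟩
      gh := h.base.gh }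
  step := by
    intro j i1 i2 v1 v2 hi
    have := h.step (-j) (-i2) (-i1) v2 v1 (by omega)
    have a := this.two
    have b := this.le
    refine ⟨by omega, by omega, ?_⟩
    intro y h1 h2
    exact this.np (-y) (by omega) (by omega)
  lt := by
    intro j i j' i' v1 v2 hj
    have := h.lt _ _ _ _ v2 v1 (by omega)
    omega
  span := by
    intro j i j' i' v1 v2
    have := h.span _ _ _ _ v2 v1
    omega

lemma Setup.pat (h : Setup G Pr g c N valid pos) : Pat (adjS G c valid pos) where
  symm := by
    rintro j i j' i' ⟨a, b, e⟩
    exact ⟨b, a, e.symm⟩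
  p0 := by
    rintro j i i' ⟨a, b, e⟩
    rcases lt_trichotomy i i' with hi | rfl | hi
    · exact h.base.pos0 (h.step _ _ _ a b hi) (h.span _ _ _ _ b a) e
    · exact e.ne rfl
    · exact h.base.pos0 (h.step _ _ _ b a hi) (h.span _ _ _ _ a b) e.symm
  pat := h.patR
  patn := by
    have := h.mirror.patR
    have he : negR (adjS G c valid pos) = adjS G (fun y => c (-y)) (fun j i => valid (-j) (-i))
        (fun j i => - pos (-j) (-i)) := by
      funext j i j' i'
      simp [negR, adjS]
    rw [he]; exact this
  p1 := by
    rintro A B a1 a2 b1 b2 hAB ha hb ⟨va1, vb1, e1⟩ ⟨va2, vb2, e2⟩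
    exact h.base.pos1 (h.step _ _ _ va1 va2 ha) (h.step _ _ _ vb1 vb2 hb)
      (h.lt _ _ _ _ va2 vb1 hAB) (h.span _ _ _ _ vb2 va1) e1 e2
  p3 := by
    rintro A B C D a1 a2 b1 b2 c1 c2 d1 d2 hAC hCB hBD ha hb hc hd ⟨va1, vb2, e1⟩ ⟨va2, vb1, e2⟩
      ⟨vc1, vd2, e3⟩ ⟨vc2, vd1, e4⟩
    exact h.base.pos3 (h.step _ _ _ va1 va2 ha) (h.step _ _ _ vc1 vc2 hc) (h.step _ _ _ vb1 vb2 hb)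
      (h.step _ _ _ vd1 vd2 hd) (h.lt _ _ _ _ va2 vc1 hAC) (h.lt _ _ _ _ vc2 vb1 hCB)
      (h.lt _ _ _ _ vb2 vd1 hBD) (h.span _ _ _ _ vd2 va1) e1 e2 e3 e4

end
end Dk


namespace Dk

section
lemma cyc_of_ham {V : Type} {G : SimpleGraph V} {n : ℕ} {σ : ZMod n → V} (hσ : Function.Bijective σ)
    (ha : ∀ i : ZMod n, G.Adj (σ i) (σ (i + 1))) : Cyc G (fun y : ℤ => σ (y : ZMod n)) n where
  adj := by
    intro y
    have := ha (y : ZMod n)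
    simpa using this
  inj := by
    intro y z
    simp only [hσ.1.eq_iff]
    rw [ZMod.intCast_eq_intCast_iff_dvd_sub, ← dvd_neg, neg_sub]

variable {V : Type} [Fintype V] [DecidableEq V] {G : SimpleGraph V} [DecidableRel G.Adj] {k : ℕ}

open Classical in
lemma finish (hα : ∀ s : Finset V, (∀ u ∈ s, ∀ v ∈ s, u ≠ v → ¬ G.Adj u v) → s.card ≤ k)
    {n D x : ℕ} (hn : Fintype.card V = n) (hn4 : 4 ≤ n) {W : Finset V} {σ : ZMod n → V}
    (hσ : Function.Bijective σ) (ha : ∀ i : ZMod n, G.Adj (σ i) (σ (i + 1)))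
    (hno : ¬ ∃ (u : V) (w : G.Walk u u), w.IsCycle ∧ w.length = n - 1 ∧
      ∀ x ∈ (W : Set V), x ∈ w.support)
    (hx : 1 ≤ x) (hkx : k < x ^ 5) (hD : 12 * (cA 5 * x) + k ≤ D)
    (hc : W.card + (D + 1) * k + 3 * (cB 5 * x ^ cE 5) ≤ n / (2 * (cA 5 * x))) : False := by
  have hcA : 1 ≤ cA 5 := by simp [cA]
  obtain ⟨ℓ, hℓ⟩ : ∃ ℓ, ℓ = cA 5 * x := ⟨_, rfl⟩
  have hℓ1 : 1 ≤ ℓ := by rw [hℓ]; exact Nat.one_le_iff_ne_zero.mpr (by positivity)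
  rw [← hℓ] at hD hc
  obtain ⟨m, hm⟩ : ∃ m, m = n / (2 * ℓ) := ⟨_, rfl⟩
  rw [← hm] at hc
  have hmn : 2 * ℓ * m ≤ n := by rw [hm]; exact Nat.mul_div_le _ _
  have hmnZ : 2 * (ℓ:ℤ) * m ≤ n := by exact_mod_cast hmn
  obtain ⟨c, hcdef⟩ : ∃ c : ℤ → V, c = fun y : ℤ => σ (y : ZMod n) := ⟨_, rfl⟩
  have hcyc : Cyc G c n := by rw [hcdef]; exact cyc_of_ham hσ ha
  let Pr : V → Prop := fun v => v ∈ W ∨ G.degree v ≤ D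
  have hbase : Base G Pr (2 * ℓ) c n :=
    { cyc := hcyc
      pos := by omega
      surj := by
        intro v
        obtain ⟨i, hi⟩ := hσ.2 v
        obtain ⟨y, hy⟩ := ZMod.intCast_surjective i
        exact ⟨y, by rw [hcdef]; simp [hy, hi]⟩
      gh := by
        intro l hl hne hcard hP
        obtain ⟨q, hq⟩ : ∃ q, (univ \ l.toFinset).card = q + 1 :=
          ⟨(univ \ l.toFinset).card - 1, by have := hne.card_pos; omega⟩
        refine gh hα hn hn4 hno q l hl hq (by omega) (D := D) ?_
        intro v hv
        have := hP v hv
        simp only [Pr, not_or, not_le] at this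
        exact ⟨this.2, this.1⟩ }
  let good : ℤ → Prop := fun j => ∀ y, 2 * ℓ * j ≤ y → y < 2 * ℓ * j + 2 * ℓ → ¬ Pr (c y)
  let valid : ℤ → ℤ → Prop := fun j i => (0 ≤ j ∧ j < m) ∧ good j ∧ 0 ≤ i ∧ i < ℓ
  let pos : ℤ → ℤ → ℤ := fun j i => 2 * ℓ * j + 2 * i
  have hlt : ∀ j j' : ℤ, j < j' → 2 * (ℓ:ℤ) * j + 2 * ℓ ≤ 2 * ℓ * j' := by
    intro j j' h
    nlinarith
  have hb0 : ∀ j : ℤ, 0 ≤ j → 0 ≤ 2 * (ℓ:ℤ) * j := by intro j hj; positivity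
  have hbm : ∀ j : ℤ, j < m → 2 * (ℓ:ℤ) * j + 2 * ℓ ≤ n := by
    intro j hj
    have := hlt j m hj
    omega
  have hS : Setup G Pr (2 * ℓ) c n valid pos :=
    { base := hbase
      step := by
        rintro j i1 i2 ⟨-, hg, h1, h2⟩ ⟨-, -, h3, h4⟩ hi
        refine ⟨?_, ?_, ?_⟩
        · simp only [pos]; omega
        · simp only [pos]; push_cast; omega
        · intro y hy1 hy2
          simp only [pos] at hy1 hy2
          exact hg y (by omega) (by omega)
      lt := by
        rintro j i j' i' ⟨-, -, h1, h2⟩ ⟨-, -, h3, h4⟩ hj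
        have := hlt j j' hj
        simp only [pos]; omega
      span := by
        rintro j i j' i' ⟨⟨h5, h6⟩, -, h1, h2⟩ ⟨⟨h7, h8⟩, -, h3, h4⟩
        have := hbm j h6
        have := hb0 j' h7
        simp only [pos]; omega }
  let J : Finset ℤ := (Finset.Ico 0 (m:ℤ)).filter good
  let B : Finset ℤ := (Finset.Ico 0 (m:ℤ)).filter (fun j => ¬ good j)
  have hJB : J.card + B.card = m := by
    have := Finset.card_filter_add_card_filter_not (s := Finset.Ico 0 (m:ℤ)) good
    simpa [J, B] using this
  have hPr : (univ.filter Pr).card ≤ W.card + (D + 1) * k := by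
    have h1 : univ.filter Pr ⊆ W ∪ univ.filter (fun v => G.degree v ≤ D) := by
      intro v hv
      simpa [Pr] using hv
    refine (Finset.card_le_card h1).trans ((Finset.card_union_le _ _).trans ?_)
    have := low_degree_count hα D
    omega
  have hB : B.card ≤ (univ.filter Pr).card := by
    have hch : ∀ j, j ∈ B → ∃ y, 2 * (ℓ:ℤ) * j ≤ y ∧ y < 2 * ℓ * j + 2 * ℓ ∧ Pr (c y) := by
      intro j hj
      have := (Finset.mem_filter.mp hj).2
      simp only [good] at this
      push Not at this
      exact this
    choose! f hf1 hf2 hf3 using hch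
    refine Finset.card_le_card_of_injOn (fun j => c (f j)) ?_ ?_
    · intro j hj
      simpa using hf3 j hj
    · intro j hj j' hj' he
      have hj := Finset.mem_coe.mp hj
      have hj' := Finset.mem_coe.mp hj'
      have r := Finset.mem_Ico.mp (Finset.mem_filter.mp hj).1
      have r' := Finset.mem_Ico.mp (Finset.mem_filter.mp hj').1
      have a1 := hf1 j hj
      have a2 := hf2 j hj
      have a3 := hf1 j' hj'
      have a4 := hf2 j' hj'
      have b1 := hb0 j r.1
      have b2 := hb0 j' r'.1
      have b3 := hbm j r.2
      have b4 := hbm j' r'.2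
      have he' := hcyc.window (w := -1) (by omega) (by omega) (by omega) (by omega) he
      rcases lt_trichotomy j j' with h | h | h
      · have := hlt _ _ h; omega
      · exact h
      · have := hlt _ _ h; omega
  obtain ⟨I, hI1, hI2, hI3⟩ := main_comb hS.pat hx (J := J) (S := fun _ => Finset.Ico 0 (ℓ:ℤ))
    (by intro j _; rw [Int.card_Ico, ← hℓ]; omega) (by omega)
  have hv : ∀ u ∈ I, valid u.1 u.2 := by
    intro u hu
    obtain ⟨h1, h2⟩ := hI1 u hu
    have h3 := Finset.mem_filter.mp h1
    have h4 := Finset.mem_Ico.mp h2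
    exact ⟨Finset.mem_Ico.mp h3.1, h3.2, h4⟩
  have hinj : Set.InjOn (fun u : ℤ × ℤ => c (pos u.1 u.2)) I := by
    intro u hu w hw he
    obtain ⟨⟨u1, u2⟩, -, u3, u4⟩ := hv u hu
    obtain ⟨⟨w1, w2⟩, -, w3, w4⟩ := hv w hw
    have b1 := hb0 _ u1
    have b2 := hb0 _ w1
    have b3 := hbm _ u2
    have b4 := hbm _ w2
    have he' := hcyc.window (w := -1) (by simp only [pos]; omega) (by simp only [pos]; omega)
      (by simp only [pos]; omega) (by simp only [pos]; omega) he
    simp only [pos] at he'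
    rcases lt_trichotomy u.1 w.1 with h | h | h
    · have := hlt _ _ h; omega
    · rw [h] at he'
      exact Prod.ext h (by omega)
    · have := hlt _ _ h; omega
  have hfin := hα (I.image (fun u : ℤ × ℤ => c (pos u.1 u.2))) (by
    intro a ha b hb _ hab
    obtain ⟨u, hu, rfl⟩ := Finset.mem_image.mp ha
    obtain ⟨w, hw, rfl⟩ := Finset.mem_image.mp hb
    exact hI2 u hu w hw ⟨hv u hu, hv w hw, hab⟩)
  rw [Finset.card_image_of_injOn hinj] at hfin
  omega

end
end Dk


namespace Dk

section
variable {V : Type} [Fintype V] [DecidableEq V] {G : SimpleGraph V} [DecidableRel G.Adj] {k : ℕ}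

/-- The constant for which Assumption (★) is contradictory. -/
noncomputable def bigC : ℝ := (22 + 24 * (cA 5 : ℝ) + 3072 * (cB 5 : ℝ)) * (4 * (cA 5 : ℝ))

lemma bigC_ge : 4 ≤ bigC := by
  unfold bigC
  have h1 : (1:ℝ) ≤ cA 5 := by exact_mod_cast (by simp [cA] : 1 ≤ cA 5)
  have h2 : (0:ℝ) ≤ cB 5 := by positivity
  nlinarith

lemma star_false
    (hα : ∀ s : Finset V, (∀ u ∈ s, ∀ v ∈ s, u ≠ v → ¬ G.Adj u v) → s.card ≤ k)
    {n : ℕ} (hn : Fintype.card V = n) {W : Finset V} {σ : ZMod n → V}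
    (hσ : Function.Bijective σ) (ha : ∀ i : ZMod n, G.Adj (σ i) (σ (i + 1)))
    (hW : W.card ≤ 20 * k ^ 2)
    (hno : ¬ ∃ (u : V) (w : G.Walk u u), w.IsCycle ∧ w.length = n - 1 ∧
      ∀ x ∈ (W : Set V), x ∈ w.support)
    (hc : bigC * (k : ℝ) ^ ((11 : ℝ) / 5) ≤ (n : ℝ)) : False := by
  have hk : 1 ≤ k := by
    have := hα {σ 0} (by
      intro u hu v hv huv
      rw [Finset.mem_singleton] at hu hv
      exact (huv (hu.trans hv.symm)).elim)
    simpa using this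
  have hkR : (1:ℝ) ≤ k := by exact_mod_cast hk
  obtain ⟨t, ht⟩ : ∃ t : ℝ, t = (k:ℝ) ^ ((1:ℝ) / 5) := ⟨_, rfl⟩
  have ht1 : 1 ≤ t := by rw [ht]; exact Real.one_le_rpow hkR (by norm_num)
  have ht5 : t ^ 5 = k := by
    rw [ht, ← Real.rpow_natCast, ← Real.rpow_mul (by positivity)]; norm_num
  have ht11 : t ^ 11 = (k:ℝ) ^ ((11:ℝ) / 5) := by
    rw [ht, ← Real.rpow_natCast, ← Real.rpow_mul (by positivity)]; norm_num
  rw [← ht11] at hc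
  have hp : ∀ q : ℕ, 1 ≤ t ^ q := fun q => one_le_pow₀ ht1
  have hn4 : 4 ≤ n := by
    have h1 := bigC_ge
    have h2 := hp 11
    have : (4:ℝ) ≤ n := by nlinarith
    exact_mod_cast this
  obtain ⟨x, hx⟩ : ∃ x : ℕ, x = ⌊t⌋₊ + 1 := ⟨_, rfl⟩
  have hxt : t < x := by rw [hx]; push_cast; exact Nat.lt_floor_add_one t
  have hx2 : (x:ℝ) ≤ 2 * t := by
    rw [hx]; push_cast
    have := Nat.floor_le (show 0 ≤ t by linarith)
    linarith
  have hkx : k < x ^ 5 := by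
    have : (k:ℝ) < x ^ 5 := by
      rw [← ht5]; exact pow_lt_pow_left₀ hxt (by linarith) (by norm_num)
    exact_mod_cast this
  refine finish hα hn hn4 hσ ha hno (x := x) (D := 12 * (cA 5 * x) + k) (by omega) hkx le_rfl ?_
  have hE : cE 5 = 10 := by simp [cE]
  have hA : 1 ≤ cA 5 := by simp [cA]
  rw [hE, Nat.le_div_iff_mul_le (Nat.mul_pos two_pos (Nat.mul_pos hA (by omega)))]
  unfold bigC at hc
  generalize cA 5 = a at *
  generalize cB 5 = b at *
  have haR : (1:ℝ) ≤ a := by exact_mod_cast hA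
  have hbR : (0:ℝ) ≤ b := by positivity
  have hWR : (W.card:ℝ) ≤ 20 * t ^ 10 := by
    have : (W.card:ℝ) ≤ 20 * k ^ 2 := by exact_mod_cast hW
    rw [← ht5] at this
    linarith [show (t ^ 5) ^ 2 = t ^ 10 by ring]
  have htt : t ≤ t ^ 5 := le_self_pow₀ ht1 (by norm_num)
  have hD : ((12 * (a * x) + k + 1 : ℕ) : ℝ) * k ≤ (24 * a + 2) * t ^ 10 := by
    push_cast
    rw [← ht5]
    have h1 : (12 * ((a:ℝ) * x) + t ^ 5 + 1) ≤ (24 * a + 2) * t ^ 5 := by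
      have : (a:ℝ) * x ≤ a * (2 * t ^ 5) := by gcongr; linarith
      nlinarith [hp 5]
    calc (12 * ((a:ℝ) * x) + t ^ 5 + 1) * t ^ 5 ≤ ((24 * a + 2) * t ^ 5) * t ^ 5 := by gcongr
      _ = _ := by ring
  have hX : 3 * ((b:ℝ) * (x:ℝ) ^ 10) ≤ 3072 * b * t ^ 10 := by
    have : (x:ℝ) ^ 10 ≤ (2 * t) ^ 10 := by gcongr
    calc 3 * ((b:ℝ) * (x:ℝ) ^ 10) ≤ 3 * (b * (2 * t) ^ 10) := by gcongr
      _ = _ := by ring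
  have hsum : (W.card:ℝ) + ((12 * (a * x) + k + 1 : ℕ) : ℝ) * k + 3 * ((b:ℝ) * (x:ℝ) ^ 10) ≤
      (22 + 24 * a + 3072 * b) * t ^ 10 := by linarith
  have hfin : ((W.card:ℝ) + ((12 * (a * x) + k + 1 : ℕ) : ℝ) * k + 3 * ((b:ℝ) * (x:ℝ) ^ 10)) *
      (2 * (a * x)) ≤ n := by
    calc _ ≤ ((22 + 24 * a + 3072 * b) * t ^ 10) * (2 * (a * (2 * t))) := by gcongr
      _ = (22 + 24 * (a:ℝ) + 3072 * b) * (4 * a) * t ^ 11 := by ring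
      _ ≤ n := hc
  exact_mod_cast hfin

end
end Dk


/-- There is a constant `c > 0` such that under Assumption (★) with
constant `c`: let `p > 1` and `x > 0`, and assume the conclusion of the main induction at
level `p − 1`.  If `𝒜` is a simple arc-system of length at least `a_p·x`, `A ∈ 𝒜`, and at
least `|A|/6` vertices `v` of `A` carry pairwise disjoint sets `F v` of at least
`b_{p−1}·x^((p−1)(p−2)/2) + 1` arcs of `𝒜` whose main part contains a `G`-neighbour of
`v`, then either there are arcs `B, C ∈ 𝒜` such that `(A, B, C)` is a Type 1
semi-triangle, or `G[𝒜]` contains an independent set of size `x^p + 1`. -/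
theorem statement12 :
    ∃ c : ℝ, 0 < c ∧
      ∀ (V : Type) [Fintype V] [DecidableEq V] (G : SimpleGraph V) [DecidableRel G.Adj]
        (n k : ℕ) (σ : ZMod n → V) (W : Finset V),
        StarAssumption G n k σ W c →
        ∀ p x : ℕ, 1 < p → 0 < x →
          (∀ y : ℕ, 0 < y → aP (p - 1) * y ≤ k →
            ∀ ℬ : ArcSystem G n k σ W,
              ℬ.Simple → ℬ.LengthGe (aP (p - 1) * y) →
              bP (p - 1) * y ^ ((p - 1) * (p - 2) / 2) ≤ ℬ.arcs.card →
              HasIndepInArcs G ℬ (y ^ (p - 1) + 1)) →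
          ∀ (𝒜 : ArcSystem G n k σ W) (A : Finset V) (S : Finset V)
            (F : V → Finset (Finset V)),
            𝒜.Simple → 𝒜.LengthGe (aP p * x) → A ∈ 𝒜.arcs →
            S ⊆ A → A.card ≤ 6 * S.card →
            (∀ v ∈ S, F v ⊆ 𝒜.arcs ∧
              bP (p - 1) * x ^ ((p - 1) * (p - 2) / 2) + 1 ≤ (F v).card ∧
              ∀ B ∈ F v, ∃ i : ZMod n, IsStart n σ (𝒜.cl B) i ∧
                ∃ M : Finset V, IsMainPart n σ i B M ∧ ∃ b ∈ M, G.Adj v b) →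
            (∀ u ∈ S, ∀ v ∈ S, u ≠ v → Disjoint (F u) (F v)) →
            (∃ B C : Finset V, SemiTriangle1 G 𝒜 A B C) ∨
              HasIndepInArcs G 𝒜 (x ^ p + 1) := by
  refine ⟨Dk.bigC, lt_of_lt_of_le (by norm_num) Dk.bigC_ge, ?_⟩
  intro V _ _ G _ n k σ W hstar
  obtain ⟨h1, h2, h3, h4, h5, h6⟩ := hstar
  exact (Dk.star_false h3 h1 h2.1 h2.2 h4 h5 h6).elim
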